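/- Let t ≥ 4 be a rational number and let G be a t-tough, non-Hamiltonian graph on n ≥ 3 vertices with a Hamilton path P = v_1 ⋯ v_n from x = v_1 to y = v_n, where x and y are nonadjacent and deg(x) + deg(y) ≥ n − t. Let p be the number of x-intervals and y-intervals of P that are not part of a joint-interval, and let q be the number of joint-intervals. Then p + q ≤ t − Σ_J (|J| − 1) − Σ_{J'} (|J'| − 2), where the first sum is over all parallel-gaps J of P and the second sum is over all crossing-gaps J' of P. -/

import Mathlib

/-- A graph `G` is `t`-tough if `|S| ≥ t · c(G − S)` for every vertex subset `S`
whose removal leaves at least two connected components. -/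
def SimpleGraph.Tough {V : Type*} [Fintype V] (t : ℚ) (G : SimpleGraph V) : Prop :=
  ∀ S : Finset V,
    2 ≤ Nat.card ((G.induce ((↑S : Set V)ᶜ)).ConnectedComponent) →
    t * (Nat.card ((G.induce ((↑S : Set V)ᶜ)).ConnectedComponent) : ℚ) ≤ (S.card : ℚ)

/-- `(i, j)` determines a `w`-interval `{v i, …, v j}` of the Hamilton path
`v 1, …, v n`: all of `v i, …, v j` are adjacent to `w` but neither `v (i−1)`
nor `v (j+1)` is. -/
def IsInterval {V : Type*} (G : SimpleGraph V) (v : ℕ → V) (n : ℕ) (w : V)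
    (i j : ℕ) : Prop :=
  2 ≤ i ∧ i ≤ j ∧ j ≤ n - 1 ∧ (∀ k, i ≤ k → k ≤ j → G.Adj (v k) w) ∧
    ¬ G.Adj (v (i - 1)) w ∧ ¬ G.Adj (v (j + 1)) w

/-- An `x`-interval (given by `a`) and a `y`-interval (given by `b`) form a
joint-interval when they share a common vertex. -/
def IsJoint {V : Type*} (G : SimpleGraph V) (v : ℕ → V) (n : ℕ)
    (a b : ℕ × ℕ) : Prop :=
  IsInterval G v n (v 1) a.1 a.2 ∧ IsInterval G v n (v n) b.1 b.2 ∧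
    b.1 ≤ a.2 ∧ a.1 ≤ b.2

/-- `(i, j)` determines an interval-gap `{v i, …, v j}`: none of `v i, …, v j`
is adjacent to `x = v 1` or `y = v n`, while each of `v (i−1)` and `v (j+1)` is
adjacent to `x` or `y`. -/
def IsGap {V : Type*} (G : SimpleGraph V) (v : ℕ → V) (n i j : ℕ) : Prop :=
  3 ≤ i ∧ i ≤ j ∧ j ≤ n - 2 ∧
  (∀ k, i ≤ k → k ≤ j → ¬ G.Adj (v k) (v 1) ∧ ¬ G.Adj (v k) (v n)) ∧
  (G.Adj (v (i - 1)) (v 1) ∨ G.Adj (v (i - 1)) (v n)) ∧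
  (G.Adj (v (j + 1)) (v 1) ∨ G.Adj (v (j + 1)) (v n))

/-- A crossing-gap: an interval-gap with `v (i−1) ∈ N(y)` and `v (j+1) ∈ N(x)`. -/
def IsCrossingGap {V : Type*} (G : SimpleGraph V) (v : ℕ → V) (n i j : ℕ) : Prop :=
  IsGap G v n i j ∧ G.Adj (v (i - 1)) (v n) ∧ G.Adj (v (j + 1)) (v 1)

/-- A parallel-gap: an interval-gap with `v (i−1), v (j+1) ∈ N(x)`, or
`v (i−1), v (j+1) ∈ N(y)`, or `v (i−1) ∈ N(x)` and `v (j+1) ∈ N(y)`. -/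
def IsParallelGap {V : Type*} (G : SimpleGraph V) (v : ℕ → V) (n i j : ℕ) : Prop :=
  IsGap G v n i j ∧
    ((G.Adj (v (i - 1)) (v 1) ∧ G.Adj (v (j + 1)) (v 1)) ∨
     (G.Adj (v (i - 1)) (v n) ∧ G.Adj (v (j + 1)) (v n)) ∨
     (G.Adj (v (i - 1)) (v 1) ∧ G.Adj (v (j + 1)) (v n)))

section ToughClosure

open Finset

/-- `Traverses H a b s`: some path of `H` from `a` to `b` has vertex set exactly `s`. -/
def Traverses (H : SimpleGraph ℕ) (a b : ℕ) (s : Finset ℕ) : Prop :=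
  ∃ l : List ℕ, ∃ h : l ≠ [], l.head h = a ∧ l.getLast h = b ∧ l.Nodup ∧
    l.IsChain H.Adj ∧ l.toFinset = s

namespace Traverses

variable {H : SimpleGraph ℕ}

theorem reverse {a b : ℕ} {s : Finset ℕ} (h : Traverses H a b s) : Traverses H b a s := by
  obtain ⟨l, hne, ha, hb, hnd, hc, hs⟩ := h
  refine ⟨l.reverse, by simpa using hne, by simpa using hb, by simpa using ha,
    by simpa using hnd, ?_, by simpa using hs⟩
  rw [List.isChain_reverse]
  exact hc.imp fun _ _ h => h.symm

theorem append {a b c d : ℕ} {s u : Finset ℕ} (h₁ : Traverses H a b s)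
    (h₂ : Traverses H c d u) (hadj : H.Adj b c) (hdisj : Disjoint s u) :
    Traverses H a d (s ∪ u) := by
  obtain ⟨l, hne, ha, hb, hnd, hc, rfl⟩ := h₁
  obtain ⟨l', hne', ha', hb', hnd', hc', rfl⟩ := h₂
  refine ⟨l ++ l', by simp [hne], ?_, ?_, ?_, ?_, by simp⟩
  · rw [List.head_append_left hne, ha]
  · rw [List.getLast_append_right hne', hb']
  · exact List.Nodup.append hnd hnd' (by
      rwa [← List.disjoint_toFinset_iff_disjoint])
  · refine List.isChain_append.2 ⟨hc, hc', ?_⟩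
    intro x hx y hy
    rw [List.getLast?_eq_some_getLast hne, Option.mem_some_iff] at hx
    rw [List.head?_eq_some_head hne', Option.mem_some_iff] at hy
    rw [← hx, ← hy, hb, ha']
    exact hadj

theorem singleton (a : ℕ) : Traverses H a a {a} :=
  ⟨[a], by simp, by simp, by simp, by simp, by simp, by simp⟩

theorem interval {n i j : ℕ} (hpath : ∀ k, 1 ≤ k → k < n → H.Adj k (k + 1)) (hi : 1 ≤ i)
    (hij : i ≤ j) (hj : j ≤ n) : Traverses H i j (Icc i j) := by
  induction j, hij using Nat.le_induction with
  | base => simpa using singleton i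
  | succ j hij ih =>
    have := (ih (by omega)).append (singleton (j + 1)) (hpath j (by omega) (by omega))
      (by simp)
    convert this using 1
    ext x; simp; omega

end Traverses

/-- The path `1, …, n` spans the initial segment `{1, …, n}` of `H`, which carries no
Hamilton cycle; in particular `1` and `n` are nonadjacent. -/
structure NonclosingPath (n : ℕ) (H : SimpleGraph ℕ) : Prop where
  three_le : 3 ≤ n
  adj_succ : ∀ k, 1 ≤ k → k < n → H.Adj k (k + 1)
  not_adj : ∀ a b, Traverses H a b (Icc 1 n) → ¬ H.Adj b a

namespace NonclosingPath

variable {n : ℕ} {H : SimpleGraph ℕ}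

theorem up (hP : NonclosingPath n H) {i j : ℕ} (hi : 1 ≤ i) (hij : i ≤ j) (hj : j ≤ n) :
    Traverses H i j (Icc i j) :=
  Traverses.interval hP.adj_succ hi hij hj

theorem down (hP : NonclosingPath n H) {i j : ℕ} (hi : 1 ≤ i) (hij : i ≤ j) (hj : j ≤ n) :
    Traverses H j i (Icc i j) :=
  (hP.up hi hij hj).reverse

theorem false_of_two (hP : NonclosingPath n H) {a b c d : ℕ} {s u : Finset ℕ}
    (h₁ : Traverses H a b s) (h₂ : Traverses H c d u) (hbc : H.Adj b c) (hda : H.Adj d a)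
    (h₁₂ : Disjoint s u) (hunion : s ∪ u = Icc 1 n) : False :=
  hP.not_adj _ _ (hunion ▸ h₁.append h₂ hbc h₁₂) hda

theorem false_of_three (hP : NonclosingPath n H) {a b c d e f : ℕ} {s u w : Finset ℕ}
    (h₁ : Traverses H a b s) (h₂ : Traverses H c d u) (h₃ : Traverses H e f w)
    (hbc : H.Adj b c) (hde : H.Adj d e) (hfa : H.Adj f a)
    (h₁₂ : Disjoint s u) (h₁₂₃ : Disjoint (s ∪ u) w) (hunion : s ∪ u ∪ w = Icc 1 n) : False :=
  hP.false_of_two (h₁.append h₂ hbc h₁₂) h₃ hde hfa h₁₂₃ hunion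

theorem false_of_four (hP : NonclosingPath n H) {a b c d e f g k : ℕ} {s u w x : Finset ℕ}
    (h₁ : Traverses H a b s) (h₂ : Traverses H c d u) (h₃ : Traverses H e f w)
    (h₄ : Traverses H g k x)
    (hbc : H.Adj b c) (hde : H.Adj d e) (hfg : H.Adj f g) (hka : H.Adj k a)
    (h₁₂ : Disjoint s u) (h₁₂₃ : Disjoint (s ∪ u) w) (h₁₂₃₄ : Disjoint (s ∪ u ∪ w) x)
    (hunion : s ∪ u ∪ w ∪ x = Icc 1 n) : False :=
  hP.false_of_three (h₁.append h₂ hbc h₁₂) h₃ h₄ hde hfg hka h₁₂₃ h₁₂₃₄ hunion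

theorem not_adj_ends (hP : NonclosingPath n H) : ¬ H.Adj 1 n := fun h =>
  hP.not_adj _ _ (hP.up le_rfl (by have := hP.three_le; omega) le_rfl) h.symm

theorem false_of_crossing (hP : NonclosingPath n H) {k : ℕ} (hk : 1 ≤ k) (hkn : k + 1 ≤ n)
    (h₁ : H.Adj 1 (k + 1)) (hn : H.Adj n k) : False := by
  refine hP.false_of_two (hP.up le_rfl hk (by omega)) (hP.down (by omega) hkn le_rfl)
    hn.symm h₁.symm ?_ ?_
  · rw [disjoint_left]; intro x; simp only [mem_Icc]; omega
  · ext x; simp only [mem_Icc, mem_union]; omega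

theorem not_adj_of_lt (hP : NonclosingPath n H) {k l : ℕ} (hk : 1 ≤ k) (hkl : k < l) (hl : l ≤ n)
    (h₁ : H.Adj 1 (k + 1)) (hn : H.Adj n (l - 1)) : ¬ H.Adj k l := by
  intro h
  have hne : l ≠ k + 1 := by
    rintro rfl
    exact hP.false_of_crossing hk hl h₁ (by simpa using hn)
  refine hP.false_of_three (hP.down le_rfl hk (by omega))
    (hP.up (i := k + 1) (j := l - 1) (by omega) (by omega) (by omega))
    (hP.down (by omega) hl le_rfl) h₁ hn.symm h.symm ?_ ?_ ?_
  · rw [disjoint_left]; intro x; simp only [mem_Icc]; omega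
  · rw [disjoint_left]; intro x; simp only [mem_Icc, mem_union]; omega
  · ext x; simp only [mem_Icc, mem_union]; omega

theorem not_adj_of_gt (hP : NonclosingPath n H) {k l : ℕ} (hl : 1 ≤ l) (hlk : l < k)
    (hkn : k + 1 ≤ n) (h₁ : H.Adj 1 (k + 1)) (hn : H.Adj n (l + 1)) : ¬ H.Adj k l := by
  intro h
  refine hP.false_of_three (hP.down (i := l + 1) (j := k) (by omega) (by omega) (by omega))
    (hP.down (by omega) hkn le_rfl)
    (hP.up le_rfl hl (by omega)) hn.symm h₁.symm h.symm ?_ ?_ ?_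
  · rw [disjoint_left]; intro x; simp only [mem_Icc]; omega
  · rw [disjoint_left]; intro x; simp only [mem_Icc, mem_union]; omega
  · ext x; simp only [mem_Icc, mem_union]; omega

theorem not_adj_of_gt' (hP : NonclosingPath n H) {k l : ℕ} (hl : 2 ≤ l) (hlk : l < k)
    (hkn : k ≤ n) (h₁ : H.Adj 1 (k - 1)) (hn : H.Adj n (l - 1)) : ¬ H.Adj k l := by
  intro h
  refine hP.false_of_three (hP.up (i := 1) (j := l - 1) le_rfl (by omega) (by omega))
    (hP.down (by omega) hkn le_rfl)
    (hP.up (i := l) (j := k - 1) (by omega) (by omega) (by omega)) hn.symm h h₁.symm ?_ ?_ ?_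
  · rw [disjoint_left]; intro x; simp only [mem_Icc]; omega
  · rw [disjoint_left]; intro x; simp only [mem_Icc, mem_union]; omega
  · ext x; simp only [mem_Icc, mem_union]; omega

theorem not_adj_right_of_bridge (hP : NonclosingPath n H) {m k b : ℕ} (hm : 2 ≤ m) (hmk : m < k)
    (hkn : k + 1 ≤ n) (h₁ : H.Adj 1 (k + 1)) (hbr : H.Adj (m - 1) k)
    (hmb : m < b) (hbn : b ≤ n) (hb : H.Adj n (b - 1)) :
    ¬ H.Adj m b := by
  intro h
  rcases lt_or_ge k b with hkb | hkb
  · have hne : b ≠ k + 1 := by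
      rintro rfl
      exact hP.false_of_crossing (by omega) hkn h₁ (by simpa using hb)
    refine hP.false_of_four (hP.up (i := 1) (j := m - 1) le_rfl (by omega) (by omega))
      (hP.down (i := m) (j := k) (by omega) (by omega) (by omega))
      (hP.up (i := b) (j := n) (by omega) (by omega) le_rfl)
      (hP.down (i := k + 1) (j := b - 1) (by omega) (by omega) (by omega))
      hbr h hb h₁.symm ?_ ?_ ?_ ?_
    · rw [disjoint_left]; intro x; simp only [mem_Icc]; omega
    · rw [disjoint_left]; intro x; simp only [mem_Icc, mem_union]; omega
    · rw [disjoint_left]; intro x; simp only [mem_Icc, mem_union]; omega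
    · ext x; simp only [mem_Icc, mem_union]; omega
  · refine hP.false_of_four (hP.up (i := 1) (j := m - 1) le_rfl (by omega) (by omega))
      (hP.down (i := b) (j := k) (by omega) (by omega) (by omega))
      (hP.up (i := m) (j := b - 1) (by omega) (by omega) (by omega))
      (hP.down (i := k + 1) (j := n) (by omega) (by omega) (by omega))
      hbr h.symm hb.symm h₁.symm ?_ ?_ ?_ ?_
    · rw [disjoint_left]; intro x; simp only [mem_Icc]; omega
    · rw [disjoint_left]; intro x; simp only [mem_Icc, mem_union]; omega
    · rw [disjoint_left]; intro x; simp only [mem_Icc, mem_union]; omega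
    · ext x; simp only [mem_Icc, mem_union]; omega

theorem not_adj_left_of_bridge (hP : NonclosingPath n H) {m k b : ℕ} (hmk : m < k)
    (hkn : k + 1 ≤ n) (h₁ : H.Adj 1 (k + 1)) (hbr : H.Adj (m - 1) k)
    (hb1 : 1 ≤ b) (hbm : b + 1 < m) (hb : H.Adj n (b + 1)) : ¬ H.Adj m b := by
  intro h
  refine hP.false_of_four (hP.up (i := 1) (j := b) le_rfl (by omega) (by omega))
    (hP.up (i := m) (j := k) (by omega) (by omega) (by omega))
    (hP.down (i := b + 1) (j := m - 1) (by omega) (by omega) (by omega))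
    (hP.down (i := k + 1) (j := n) (by omega) (by omega) (by omega))
    h.symm hbr.symm hb.symm h₁.symm ?_ ?_ ?_ ?_
  · rw [disjoint_left]; intro x; simp only [mem_Icc]; omega
  · rw [disjoint_left]; intro x; simp only [mem_Icc, mem_union]; omega
  · rw [disjoint_left]; intro x; simp only [mem_Icc, mem_union]; omega
  · ext x; simp only [mem_Icc, mem_union]; omega

theorem not_adj_of_consecutive (hP : NonclosingPath n H) {a b u : ℕ} (ha : 1 ≤ a) (hau : a < u)
    (hub : u + 1 < b) (hbn : b ≤ n) (h₁ : H.Adj 1 (a + 1)) (hb : H.Adj n (b - 1))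
    (h : H.Adj u b) : ¬ H.Adj (u + 1) a := by
  intro h'
  refine hP.false_of_four (hP.up (i := 1) (j := a) le_rfl (by omega) (by omega))
    (hP.up (i := u + 1) (j := b - 1) (by omega) (by omega) (by omega))
    (hP.down (i := b) (j := n) (by omega) (by omega) (by omega))
    (hP.down (i := a + 1) (j := u) (by omega) (by omega) (by omega))
    h'.symm hb.symm h.symm h₁.symm ?_ ?_ ?_ ?_
  · rw [disjoint_left]; intro x; simp only [mem_Icc]; omega
  · rw [disjoint_left]; intro x; simp only [mem_Icc, mem_union]; omega
  · rw [disjoint_left]; intro x; simp only [mem_Icc, mem_union]; omega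
  · ext x; simp only [mem_Icc, mem_union]; omega

end NonclosingPath

/-- The reversal of the path `1, …, n`. -/
def reflect (n : ℕ) (H : SimpleGraph ℕ) : SimpleGraph ℕ :=
  H.comap fun i => n + 1 - i

theorem reflect_adj {n : ℕ} {H : SimpleGraph ℕ} {i j : ℕ} :
    (reflect n H).Adj i j ↔ H.Adj (n + 1 - i) (n + 1 - j) :=
  Iff.rfl

theorem card_eq_of_reflect {n : ℕ} {s u : Finset ℕ} (hs : s ⊆ Icc 1 n) (hu : u ⊆ Icc 1 n)
    (h : ∀ i ∈ Icc 1 n, i ∈ s ↔ n + 1 - i ∈ u) : #s = #u := by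
  refine card_bij' (fun i _ => n + 1 - i) (fun i _ => n + 1 - i) ?_ ?_ ?_ ?_
  · intro i hi
    exact (h i (hs hi)).1 hi
  · intro i hi
    have := mem_Icc.1 (hu hi)
    refine (h _ (mem_Icc.2 (by omega))).2 ?_
    rwa [show n + 1 - (n + 1 - i) = i by omega]
  · intro i hi
    have := mem_Icc.1 (hs hi)
    omega
  · intro i hi
    have := mem_Icc.1 (hu hi)
    omega

theorem Traverses.of_reflect {n : ℕ} {H : SimpleGraph ℕ} {a b : ℕ}
    (h : Traverses (reflect n H) a b (Icc 1 n)) :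
    Traverses H (n + 1 - a) (n + 1 - b) (Icc 1 n) := by
  obtain ⟨l, hne, rfl, rfl, hnd, hc, hs⟩ := h
  have hmem : ∀ i ∈ l, 1 ≤ i ∧ i ≤ n := fun i hi => by
    rw [← mem_Icc, ← hs]; simpa using hi
  refine ⟨l.map fun i => n + 1 - i, by simpa using hne, by simp, by simp, ?_, ?_, ?_⟩
  · refine hnd.map_on fun i hi j hj hij => ?_
    have := hmem i hi
    have := hmem j hj
    omega
  · exact (List.isChain_map _).2 hc
  · ext x
    have hx : x ∈ Icc 1 n ↔ n + 1 - x ∈ Icc 1 n := by simp only [mem_Icc]; omega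
    simp only [List.mem_toFinset, List.mem_map]
    constructor
    · rintro ⟨i, hi, rfl⟩
      have := hmem i hi
      simp only [mem_Icc]; omega
    · intro h
      have h' := hx.1 h
      rw [← hs, List.mem_toFinset] at h'
      have := mem_Icc.1 h
      exact ⟨_, h', by omega⟩

theorem NonclosingPath.reflect {n : ℕ} {H : SimpleGraph ℕ} (hP : NonclosingPath n H) :
    NonclosingPath n (reflect n H) where
  three_le := hP.three_le
  adj_succ k hk hkn := by
    have := (hP.adj_succ (n - k) (by omega) (by omega)).symm
    rw [reflect_adj]
    convert this using 1 <;> omega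
  not_adj a b h hba := hP.not_adj _ _ h.of_reflect hba

open Classical in
/-- The path predecessors of the neighbours of `1`. -/
noncomputable def predSet (H : SimpleGraph ℕ) (n : ℕ) : Finset ℕ :=
  {k ∈ Icc 1 (n - 1) | H.Adj 1 (k + 1)}

open Classical in
/-- The path successors of the neighbours of `n`. -/
noncomputable def succSet (H : SimpleGraph ℕ) (n : ℕ) : Finset ℕ :=
  {l ∈ Icc 2 n | H.Adj n (l - 1)}

open Classical in
/-- The non-initial elements of `predSet` that are nonadjacent to `1` and not in `succSet`. -/
noncomputable def strayPred (H : SimpleGraph ℕ) (n : ℕ) : Finset ℕ :=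
  {f ∈ predSet H n | ¬ H.Adj 1 f ∧ f ≠ 1 ∧ f ∉ succSet H n}

open Classical in
/-- The non-final elements of `succSet` that are nonadjacent to `n` and not in `predSet`. -/
noncomputable def straySucc (H : SimpleGraph ℕ) (n : ℕ) : Finset ℕ :=
  {m ∈ succSet H n | ¬ H.Adj n m ∧ m ≠ n ∧ m ∉ predSet H n}

open Classical in
/-- The elements of `strayPred` whose successor has a neighbour in `succSet` further left. -/
noncomputable def bridgedPred (H : SimpleGraph ℕ) (n : ℕ) : Finset ℕ :=
  {f ∈ strayPred H n | ∃ l ∈ succSet H n, l < f ∧ H.Adj (f + 1) l}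

open Classical in
/-- The elements of `straySucc` whose predecessor has a neighbour in `predSet` further right. -/
noncomputable def bridgedSucc (H : SimpleGraph ℕ) (n : ℕ) : Finset ℕ :=
  {m ∈ straySucc H n | ∃ k ∈ predSet H n, m < k ∧ H.Adj (m - 1) k}

open Classical in
/-- The vertices other than `1` that are nonadjacent to `1` and whose predecessor is
nonadjacent to `n`. -/
noncomputable def gapSet (H : SimpleGraph ℕ) (n : ℕ) : Finset ℕ :=
  {i ∈ Icc 2 n | ¬ H.Adj 1 i ∧ ¬ H.Adj n (i - 1)}

section Membership

variable {n : ℕ} {H : SimpleGraph ℕ} {i : ℕ}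

theorem mem_predSet : i ∈ predSet H n ↔ 1 ≤ i ∧ i + 1 ≤ n ∧ H.Adj 1 (i + 1) := by
  simp only [predSet, mem_filter, mem_Icc, and_assoc]
  constructor
  · rintro ⟨h, h', h''⟩; exact ⟨h, by omega, h''⟩
  · rintro ⟨h, h', h''⟩; exact ⟨h, by omega, h''⟩

theorem mem_succSet : i ∈ succSet H n ↔ 2 ≤ i ∧ i ≤ n ∧ H.Adj n (i - 1) := by
  simp only [succSet, mem_filter, mem_Icc, and_assoc]

theorem mem_strayPred :
    i ∈ strayPred H n ↔ i ∈ predSet H n ∧ ¬ H.Adj 1 i ∧ i ≠ 1 ∧ i ∉ succSet H n := by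
  simp only [strayPred, mem_filter]

theorem mem_straySucc :
    i ∈ straySucc H n ↔ i ∈ succSet H n ∧ ¬ H.Adj n i ∧ i ≠ n ∧ i ∉ predSet H n := by
  simp only [straySucc, mem_filter]

theorem mem_bridgedPred :
    i ∈ bridgedPred H n ↔ i ∈ strayPred H n ∧ ∃ l ∈ succSet H n, l < i ∧ H.Adj (i + 1) l := by
  simp only [bridgedPred, mem_filter]

theorem mem_bridgedSucc :
    i ∈ bridgedSucc H n ↔ i ∈ straySucc H n ∧ ∃ k ∈ predSet H n, i < k ∧ H.Adj (i - 1) k := by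
  simp only [bridgedSucc, mem_filter]

theorem mem_gapSet :
    i ∈ gapSet H n ↔ 2 ≤ i ∧ i ≤ n ∧ ¬ H.Adj 1 i ∧ ¬ H.Adj n (i - 1) := by
  simp only [gapSet, mem_filter, mem_Icc, and_assoc]

theorem mem_predSet_reflect (hi : 1 ≤ i) (hin : i ≤ n) :
    i ∈ predSet (reflect n H) n ↔ n + 1 - i ∈ succSet H n := by
  rw [mem_predSet, mem_succSet, reflect_adj, show n + 1 - 1 = n by omega,
    show n + 1 - (i + 1) = n + 1 - i - 1 by omega]
  constructor
  · rintro ⟨h, h', h''⟩; exact ⟨by omega, by omega, h''⟩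
  · rintro ⟨h, h', h''⟩; exact ⟨by omega, by omega, h''⟩

theorem mem_succSet_reflect (hi : 1 ≤ i) (hin : i ≤ n) :
    i ∈ succSet (reflect n H) n ↔ n + 1 - i ∈ predSet H n := by
  rw [mem_predSet, mem_succSet, reflect_adj, show n + 1 - n = 1 by omega]
  constructor
  · rintro ⟨h, h', h''⟩
    exact ⟨by omega, by omega, by rwa [show n + 1 - i + 1 = n + 1 - (i - 1) by omega]⟩
  · rintro ⟨h, h', h''⟩
    exact ⟨by omega, by omega, by rwa [show n + 1 - (i - 1) = n + 1 - i + 1 by omega]⟩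

theorem mem_strayPred_reflect (hi : 1 ≤ i) (hin : i ≤ n) :
    i ∈ strayPred (reflect n H) n ↔ n + 1 - i ∈ straySucc H n := by
  rw [mem_strayPred, mem_straySucc, mem_predSet_reflect hi hin, mem_succSet_reflect hi hin,
    reflect_adj, show n + 1 - 1 = n by omega, show i ≠ 1 ↔ n + 1 - i ≠ n by omega]

theorem mem_straySucc_reflect (hi : 1 ≤ i) (hin : i ≤ n) :
    i ∈ straySucc (reflect n H) n ↔ n + 1 - i ∈ strayPred H n := by
  rw [mem_strayPred, mem_straySucc, mem_predSet_reflect hi hin, mem_succSet_reflect hi hin,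
    reflect_adj, show n + 1 - n = 1 by omega, show i ≠ n ↔ n + 1 - i ≠ 1 by omega]

theorem predSet_subset : predSet H n ⊆ Icc 1 n := fun i hi => by
  have := mem_predSet.1 hi
  simp only [mem_Icc]; omega

theorem succSet_subset : succSet H n ⊆ Icc 1 n := fun i hi => by
  have := mem_succSet.1 hi
  simp only [mem_Icc]; omega

theorem strayPred_subset : strayPred H n ⊆ Icc 1 n := fun _ hi =>
  predSet_subset (mem_strayPred.1 hi).1

theorem straySucc_subset : straySucc H n ⊆ Icc 1 n := fun _ hi =>
  succSet_subset (mem_straySucc.1 hi).1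

theorem bridgedPred_subset : bridgedPred H n ⊆ strayPred H n := fun _ hi =>
  (mem_bridgedPred.1 hi).1

theorem bridgedSucc_subset : bridgedSucc H n ⊆ straySucc H n := fun _ hi =>
  (mem_bridgedSucc.1 hi).1

theorem mem_bridgedPred_reflect (hi : 1 ≤ i) (hin : i ≤ n) :
    i ∈ bridgedPred (reflect n H) n ↔ n + 1 - i ∈ bridgedSucc H n := by
  rw [mem_bridgedPred, mem_bridgedSucc, mem_strayPred_reflect hi hin]
  refine and_congr_right fun _ => ⟨?_, ?_⟩
  · rintro ⟨l, hl, hli, h⟩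
    have hl' := mem_Icc.1 (succSet_subset hl)
    refine ⟨n + 1 - l, (mem_succSet_reflect hl'.1 hl'.2).1 hl, by omega, ?_⟩
    rwa [reflect_adj, show n + 1 - (i + 1) = n + 1 - i - 1 by omega] at h
  · rintro ⟨k, hk, hik, h⟩
    have hk' := mem_Icc.1 (predSet_subset hk)
    refine ⟨n + 1 - k, (mem_succSet_reflect (by omega) (by omega)).2 ?_, by omega, ?_⟩
    · rwa [show n + 1 - (n + 1 - k) = k by omega]
    · rwa [reflect_adj, show n + 1 - (i + 1) = n + 1 - i - 1 by omega,
        show n + 1 - (n + 1 - k) = k by omega]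

theorem mem_bridgedSucc_reflect (hi : 1 ≤ i) (hin : i ≤ n) :
    i ∈ bridgedSucc (reflect n H) n ↔ n + 1 - i ∈ bridgedPred H n := by
  rw [mem_bridgedPred, mem_bridgedSucc, mem_straySucc_reflect hi hin]
  refine and_congr_right fun h₀ => ⟨?_, ?_⟩
  · rintro ⟨k, hk, hik, h⟩
    have hk' := mem_Icc.1 (predSet_subset hk)
    refine ⟨n + 1 - k, (mem_predSet_reflect hk'.1 hk'.2).1 hk, by omega, ?_⟩
    rw [reflect_adj] at h
    convert h using 1
    have := mem_succSet.1 (mem_straySucc.1 ((mem_straySucc_reflect hi hin).2 h₀)).1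
    omega
  · rintro ⟨l, hl, hli, h⟩
    have hl' := mem_Icc.1 (succSet_subset hl)
    refine ⟨n + 1 - l, (mem_predSet_reflect (by omega) (by omega)).2 ?_, by omega, ?_⟩
    · rwa [show n + 1 - (n + 1 - l) = l by omega]
    · rw [reflect_adj]
      have := mem_succSet.1 (mem_straySucc.1 ((mem_straySucc_reflect hi hin).2 h₀)).1
      rwa [show n + 1 - (i - 1) = n + 1 - i + 1 by omega,
        show n + 1 - (n + 1 - l) = l by omega]

theorem card_predSet_reflect : #(predSet (reflect n H) n) = #(succSet H n) :=
  card_eq_of_reflect predSet_subset succSet_subset fun _ hi =>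
    mem_predSet_reflect (mem_Icc.1 hi).1 (mem_Icc.1 hi).2

theorem card_succSet_reflect : #(succSet (reflect n H) n) = #(predSet H n) :=
  card_eq_of_reflect succSet_subset predSet_subset fun _ hi =>
    mem_succSet_reflect (mem_Icc.1 hi).1 (mem_Icc.1 hi).2

theorem card_inter_reflect :
    #(predSet (reflect n H) n ∩ succSet (reflect n H) n) = #(predSet H n ∩ succSet H n) := by
  refine card_eq_of_reflect (inter_subset_left.trans predSet_subset)
    (inter_subset_left.trans predSet_subset) fun i hi => ?_
  rw [mem_inter, mem_inter, mem_predSet_reflect (mem_Icc.1 hi).1 (mem_Icc.1 hi).2,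
    mem_succSet_reflect (mem_Icc.1 hi).1 (mem_Icc.1 hi).2, and_comm]

theorem card_bridgedPred_reflect : #(bridgedPred (reflect n H) n) = #(bridgedSucc H n) :=
  card_eq_of_reflect (bridgedPred_subset.trans strayPred_subset)
    (bridgedSucc_subset.trans straySucc_subset) fun _ hi =>
      mem_bridgedPred_reflect (mem_Icc.1 hi).1 (mem_Icc.1 hi).2

theorem card_bridgedSucc_reflect : #(bridgedSucc (reflect n H) n) = #(bridgedPred H n) :=
  card_eq_of_reflect (bridgedSucc_subset.trans straySucc_subset)
    (bridgedPred_subset.trans strayPred_subset) fun _ hi =>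
      mem_bridgedSucc_reflect (mem_Icc.1 hi).1 (mem_Icc.1 hi).2

end Membership

section Pivots

variable {n : ℕ} {H : SimpleGraph ℕ}

/-- An interior vertex with no neighbour in `predSet` to its left, none in `succSet` to its
right, and none among the path successors of `N(1)` in `predSet` or the path predecessors of
`N(n)` in `succSet`. -/
structure IsPivot (n : ℕ) (H : SimpleGraph ℕ) (p : ℕ) : Prop where
  two_lt : 2 < p
  lt_pred : p + 1 < n
  not_adj_pred : ∀ k ∈ predSet H n, k < p ∨ 1 < k ∧ H.Adj 1 (k - 1) → ¬ H.Adj p k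
  not_adj_succ : ∀ l ∈ succSet H n, p < l ∨ l < n ∧ H.Adj n (l + 1) → ¬ H.Adj p l

theorem pred_of_notMem_strayPred {k : ℕ} (hk : k ∈ predSet H n)
    (hkB : k ∉ succSet H n) (hkF : k ∉ strayPred H n)
    (hW : k - 1 ∉ predSet H n ∩ succSet H n) (hF : k - 1 ∉ strayPred H n) :
    k ≤ 2 ∨ 1 < k ∧ H.Adj 1 (k - 1) := by
  have hk' := mem_predSet.1 hk
  by_contra! hcon
  have hk1 : H.Adj 1 k := by
    by_contra h
    exact hkF (mem_strayPred.2 ⟨hk, h, by omega, hkB⟩)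
  have hpred : k - 1 ∈ predSet H n :=
    mem_predSet.2 ⟨by omega, by omega, by rwa [show k - 1 + 1 = k by omega]⟩
  exact hF (mem_strayPred.2 ⟨hpred, hcon.2 (by omega), by omega,
    fun h => hW (mem_inter.2 ⟨hpred, h⟩)⟩)

theorem succ_of_notMem_straySucc {l : ℕ} (hl : l ∈ succSet H n)
    (hlA : l ∉ predSet H n) (hlM : l ∉ straySucc H n)
    (hW : l + 1 ∉ predSet H n ∩ succSet H n) (hM : l + 1 ∉ straySucc H n) :
    n ≤ l + 1 ∨ l < n ∧ H.Adj n (l + 1) := by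
  have hl' := mem_succSet.1 hl
  by_contra! hcon
  have hln : H.Adj n l := by
    by_contra h
    exact hlM (mem_straySucc.2 ⟨hl, h, by omega, hlA⟩)
  have hsucc : l + 1 ∈ succSet H n :=
    mem_succSet.2 ⟨by omega, by omega, by simpa using hln⟩
  exact hM (mem_straySucc.2 ⟨hsucc, hcon.2 (by omega), by omega,
    fun h => hW (mem_inter.2 ⟨h, hsucc⟩)⟩)

namespace NonclosingPath

theorem one_mem_predSet (hP : NonclosingPath n H) : 1 ∈ predSet H n := by
  have := hP.three_le
  exact mem_predSet.2 ⟨le_rfl, by omega, hP.adj_succ 1 le_rfl (by omega)⟩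

theorem last_mem_succSet (hP : NonclosingPath n H) : n ∈ succSet H n := by
  have := hP.three_le
  refine mem_succSet.2 ⟨by omega, le_rfl, ?_⟩
  have h := (hP.adj_succ (n - 1) (by omega) (by omega)).symm
  rwa [show n - 1 + 1 = n by omega] at h

theorem add_two_le_of_mem_predSet (hP : NonclosingPath n H) {k : ℕ} (hk : k ∈ predSet H n) :
    k + 2 ≤ n := by
  obtain ⟨_, hkn, h⟩ := mem_predSet.1 hk
  by_contra hlt
  rw [show k + 1 = n by omega] at h
  exact hP.not_adj_ends h

theorem three_le_of_mem_succSet (hP : NonclosingPath n H) {l : ℕ} (hl : l ∈ succSet H n) :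
    3 ≤ l := by
  obtain ⟨hl2, _, h⟩ := mem_succSet.1 hl
  by_contra hlt
  rw [show l - 1 = 1 by omega] at h
  exact hP.not_adj_ends h.symm

theorem not_adj_of_mem_of_lt (hP : NonclosingPath n H) {k l : ℕ} (hk : k ∈ predSet H n)
    (hl : l ∈ succSet H n) (hkl : k < l) : ¬ H.Adj k l := by
  rw [mem_predSet] at hk
  rw [mem_succSet] at hl
  exact hP.not_adj_of_lt hk.1 hkl hl.2.1 hk.2.2 hl.2.2

theorem not_adj_of_pred (hP : NonclosingPath n H) {k l : ℕ} (hk : k ∈ predSet H n)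
    (hl : l ∈ succSet H n) (h : k ≤ 2 ∨ 1 < k ∧ H.Adj 1 (k - 1)) : ¬ H.Adj k l := by
  rcases lt_trichotomy k l with hkl | rfl | hlk
  · exact hP.not_adj_of_mem_of_lt hk hl hkl
  · exact H.irrefl
  · have := hP.three_le_of_mem_succSet hl
    have hkn := mem_predSet.1 hk
    have hl' := mem_succSet.1 hl
    rcases h with h | h
    · omega
    · exact hP.not_adj_of_gt' hl'.1 hlk (by omega) h.2 hl'.2.2

theorem not_adj_of_succ (hP : NonclosingPath n H) {k l : ℕ} (hk : k ∈ predSet H n)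
    (hl : l ∈ succSet H n) (h : n ≤ l + 1 ∨ l < n ∧ H.Adj n (l + 1)) : ¬ H.Adj k l := by
  rcases lt_trichotomy k l with hkl | rfl | hlk
  · exact hP.not_adj_of_mem_of_lt hk hl hkl
  · exact H.irrefl
  · have := hP.add_two_le_of_mem_predSet hk
    have hk' := mem_predSet.1 hk
    have hl' := mem_succSet.1 hl
    rcases h with h | h
    · omega
    · exact hP.not_adj_of_gt (by omega) hlk hk'.2.1 hk'.2.2 h.2

theorem isPivot_of_mem_inter (hP : NonclosingPath n H) {w : ℕ}
    (hw : w ∈ predSet H n ∩ succSet H n) : IsPivot n H w := by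
  obtain ⟨hA, hB⟩ := mem_inter.1 hw
  have h1 := hP.add_two_le_of_mem_predSet hA
  have h2 := hP.three_le_of_mem_succSet hB
  refine ⟨by omega, by omega, fun k hk h hadj => ?_, fun l hl h hadj => ?_⟩
  · rcases h with h | h
    · exact hP.not_adj_of_mem_of_lt hk hB h hadj.symm
    · exact hP.not_adj_of_pred hk hB (Or.inr h) hadj.symm
  · rcases h with h | h
    · exact hP.not_adj_of_mem_of_lt hA hl h hadj
    · exact hP.not_adj_of_succ hA hl (Or.inr h) hadj

theorem isPivot_of_mem_bridgedSucc (hP : NonclosingPath n H) {m : ℕ}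
    (hm : m ∈ bridgedSucc H n) : IsPivot n H m := by
  obtain ⟨hM, k, hk, hmk, hbr⟩ := mem_bridgedSucc.1 hm
  obtain ⟨hB, hmY, -, -⟩ := mem_straySucc.1 hM
  have h1 := hP.add_two_le_of_mem_predSet hk
  have h2 := hP.three_le_of_mem_succSet hB
  have hk' := mem_predSet.1 hk
  refine ⟨by omega, by omega, fun a ha h hadj => ?_, fun b hb h hadj => ?_⟩
  · rcases h with h | h
    · exact hP.not_adj_of_mem_of_lt ha hB h hadj.symm
    · exact hP.not_adj_of_pred ha hB (Or.inr h) hadj.symm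
  · have hb' := mem_succSet.1 hb
    rcases lt_trichotomy m b with hlt | rfl | hgt
    · exact hP.not_adj_right_of_bridge (by omega) hmk hk'.2.1 hk'.2.2 hbr hlt hb'.2.1 hb'.2.2 hadj
    · exact H.irrefl hadj
    · rcases h with h | h
      · omega
      · rcases eq_or_ne (b + 1) m with rfl | hne
        · exact hmY h.2
        · exact hP.not_adj_left_of_bridge hmk hk'.2.1 hk'.2.2 hbr (by omega) (by omega) h.2 hadj

theorem not_adj_succ_of_notMem_bridgedPred (hP : NonclosingPath n H) {f l : ℕ}
    (hf : f ∈ strayPred H n) (hfU : f ∉ bridgedPred H n) (hf' : f + 1 ∈ predSet H n)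
    (hl : l ∈ succSet H n) : ¬ H.Adj (f + 1) l := by
  intro h
  rcases lt_trichotomy f l with hlt | rfl | hgt
  · rcases eq_or_lt_of_le (Nat.succ_le_of_lt hlt) with rfl | hlt
    · exact H.irrefl h
    · exact hP.not_adj_of_mem_of_lt hf' hl hlt h
  · exact (mem_strayPred.1 hf).2.2.2 hl
  · exact hfU (mem_bridgedPred.2 ⟨hf, l, hl, hgt, h⟩)

theorem not_adj_pred_of_notMem_bridgedSucc (hP : NonclosingPath n H) {k m : ℕ}
    (hm : m + 1 ∈ straySucc H n) (hmU : m + 1 ∉ bridgedSucc H n) (hm' : m ∈ succSet H n)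
    (hk : k ∈ predSet H n) : ¬ H.Adj k m := by
  intro h
  rcases lt_trichotomy k (m + 1) with hlt | rfl | hgt
  · rcases eq_or_lt_of_le (Nat.lt_succ_iff.1 hlt) with rfl | hlt
    · exact H.irrefl h
    · exact hP.not_adj_of_mem_of_lt hk hm' hlt h
  · exact (mem_straySucc.1 hm).2.2.2 hk
  · exact hmU (mem_bridgedSucc.2 ⟨hm, k, hk, hgt, h.symm⟩)

/-- An element of `predSet` away from the stray and common elements has no neighbour in
`succSet`. -/
theorem not_adj_of_notMem_bridgedPred (hP : NonclosingPath n H) {k l : ℕ} (hk : k ∈ predSet H n)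
    (hkB : k ∉ succSet H n) (hkF : k ∉ strayPred H n)
    (hW : k - 1 ∉ predSet H n ∩ succSet H n) (hU : k - 1 ∉ bridgedPred H n)
    (hl : l ∈ succSet H n) : ¬ H.Adj k l := by
  by_cases hF : k - 1 ∈ strayPred H n
  · have h := mem_predSet.1 (mem_strayPred.1 hF).1
    have hk1 : k - 1 + 1 = k := by omega
    have := hP.not_adj_succ_of_notMem_bridgedPred hF hU (by rwa [hk1]) hl
    rwa [hk1] at this
  · exact hP.not_adj_of_pred hk hl (pred_of_notMem_strayPred hk hkB hkF hW hF)

/-- An element of `succSet` away from the stray and common elements has no neighbour in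
`predSet`. -/
theorem not_adj_of_notMem_bridgedSucc (hP : NonclosingPath n H) {k l : ℕ} (hl : l ∈ succSet H n)
    (hlA : l ∉ predSet H n) (hlM : l ∉ straySucc H n)
    (hW : l + 1 ∉ predSet H n ∩ succSet H n) (hU : l + 1 ∉ bridgedSucc H n)
    (hk : k ∈ predSet H n) : ¬ H.Adj k l := by
  by_cases hM : l + 1 ∈ straySucc H n
  · exact hP.not_adj_pred_of_notMem_bridgedSucc hM hU hl hk
  · exact hP.not_adj_of_succ hk hl (succ_of_notMem_straySucc hl hlA hlM hW hM)

end NonclosingPath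

end Pivots

section Counting

variable {n : ℕ} {H : SimpleGraph ℕ}

theorem strayPred_subset_gapSet : strayPred H n ⊆ gapSet H n := fun i hi => by
  obtain ⟨hA, hX, h1, hB⟩ := mem_strayPred.1 hi
  have hA' := mem_predSet.1 hA
  exact mem_gapSet.2 ⟨by omega, by omega, hX,
    fun h => hB (mem_succSet.2 ⟨by omega, by omega, h⟩)⟩

theorem succ_mem_gapSet {i : ℕ} (hi : i ∈ straySucc H n) : i + 1 ∈ gapSet H n := by
  obtain ⟨hB, hY, hn, hA⟩ := mem_straySucc.1 hi
  have hB' := mem_succSet.1 hB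
  exact mem_gapSet.2 ⟨by omega, by omega, fun h => hA (mem_predSet.2 ⟨by omega, by omega, h⟩), hY⟩

theorem card_strayPred_le : #(strayPred H n) ≤ #(gapSet H n) :=
  card_le_card strayPred_subset_gapSet

theorem card_straySucc_le : #(straySucc H n) ≤ #(gapSet H n) :=
  card_le_card_of_injOn (· + 1) (fun _ hi => succ_mem_gapSet hi) (by simp)

theorem NonclosingPath.card_gapSet (hP : NonclosingPath n H) :
    #(gapSet H n) + #(predSet H n) + #(succSet H n) + 1 = n := by
  have h3 := hP.three_le
  have hsub : (predSet H n).image (· + 1) ∪ succSet H n ⊆ Icc 2 n := by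
    intro i hi
    rcases mem_union.1 hi with hi | hi
    · obtain ⟨k, hk, rfl⟩ := mem_image.1 hi
      have := mem_predSet.1 hk
      simp only [mem_Icc]; omega
    · have := mem_succSet.1 hi
      simp only [mem_Icc]; omega
  have hdisj : Disjoint ((predSet H n).image (· + 1)) (succSet H n) := by
    rw [disjoint_left]
    rintro i hi hB
    obtain ⟨k, hk, rfl⟩ := mem_image.1 hi
    have hk' := mem_predSet.1 hk
    exact hP.false_of_crossing hk'.1 hk'.2.1 hk'.2.2 (mem_succSet.1 hB).2.2
  have hgap : gapSet H n = Icc 2 n \ ((predSet H n).image (· + 1) ∪ succSet H n) := by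
    ext i
    simp only [mem_gapSet, mem_sdiff, mem_union, mem_image, mem_Icc, not_or, mem_succSet]
    constructor
    · rintro ⟨h2, hn, hX, hB⟩
      refine ⟨⟨h2, hn⟩, ?_, fun h => hB h.2.2⟩
      rintro ⟨k, hk, rfl⟩
      exact hX (mem_predSet.1 hk).2.2
    · rintro ⟨⟨h2, hn⟩, hX, hB⟩
      refine ⟨h2, hn, fun h => hX ⟨i - 1, mem_predSet.2 ⟨by omega, by omega, ?_⟩, by omega⟩,
        fun h => hB ⟨h2, hn, h⟩⟩
      rwa [show i - 1 + 1 = i by omega]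
  have hcard := card_sdiff_add_card_eq_card hsub
  rw [← hgap, card_union_of_disjoint hdisj, card_image_of_injective _ (add_left_injective 1),
    Nat.card_Icc] at hcard
  omega

/-- A spanning path `1, …, n` of a graph on `{1, …, n}` with no Hamilton cycle, where the graph
is `t`-tough (phrased through colourings that are constant on components) and the degrees of the
ends of the path sum to at least `n - t`. -/
structure ToughPath (t : ℚ) (n : ℕ) (H : SimpleGraph ℕ) : Prop extends NonclosingPath n H where
  four_le : 4 ≤ t
  tough : ∀ (K : Finset ℕ) (col : ℕ → ℕ), K ⊆ Icc 1 n →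
    (∀ i ∈ K, ∀ j ∈ K, H.Adj i j → col i = col j) → 2 ≤ #(K.image col) →
    t * #(K.image col) + #K ≤ n
  degree_sum : (n : ℚ) - t ≤ #(predSet H n) + #(succSet H n)

namespace ToughPath

variable {t : ℚ}

theorem reflect (hT : ToughPath t n H) : ToughPath t n (reflect n H) where
  toNonclosingPath := hT.toNonclosingPath.reflect
  four_le := hT.four_le
  tough K col hK hcol h2 := by
    have hinv : ∀ i ∈ Icc 1 n, n + 1 - (n + 1 - i) = i := fun i hi => by
      have := mem_Icc.1 hi
      omega
    have hinj : Set.InjOn (fun i => n + 1 - i) (K : Set ℕ) := fun i hi j hj hij => by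
      have := mem_Icc.1 (hK hi)
      have := mem_Icc.1 (hK hj)
      simp only at hij
      omega
    have himg : (K.image fun i => n + 1 - i).image (fun i => col (n + 1 - i)) = K.image col := by
      rw [image_image]
      refine image_congr fun i hi => ?_
      simp only [Function.comp_apply, hinv i (hK hi)]
    have h := hT.tough (K.image fun i => n + 1 - i) (fun i => col (n + 1 - i)) ?_ ?_ ?_
    · rwa [himg, card_image_of_injOn hinj] at h
    · intro i hi
      obtain ⟨j, hj, rfl⟩ := mem_image.1 hi
      have := mem_Icc.1 (hK hj)
      simp only [mem_Icc]; omega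
    · intro i hi j hj hij
      obtain ⟨i', hi', rfl⟩ := mem_image.1 hi
      obtain ⟨j', hj', rfl⟩ := mem_image.1 hj
      simp only [hinv i' (hK hi'), hinv j' (hK hj')]
      exact hcol i' hi' j' hj' hij
    · rwa [himg]
  degree_sum := by
    rw [card_predSet_reflect, card_succSet_reflect, add_comm]
    exact hT.degree_sum

theorem card_gapSet_le (hT : ToughPath t n H) : (#(gapSet H n) : ℚ) + 1 ≤ t := by
  have h := hT.card_gapSet
  have h' : ((#(gapSet H n) + #(predSet H n) + #(succSet H n) + 1 : ℕ) : ℚ) = n := by rw [h]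
  push_cast at h'
  linarith [hT.degree_sum]

theorem card_gapSet_reflect (hT : ToughPath t n H) :
    #(gapSet (_root_.reflect n H) n) = #(gapSet H n) := by
  have h := hT.card_gapSet
  have h' := hT.reflect.card_gapSet
  rw [card_predSet_reflect, card_succSet_reflect] at h'
  omega

/-- Toughness applied to the complement of a subset of `predSet ∪ succSet` in which the elements
of `P` are isolated and the remaining elements split into two nonempty parts. -/
theorem cut_le (hT : ToughPath t n H) (D P : Finset ℕ) (side : ℕ → Prop)
    (hP : ∀ p ∈ P, p ∈ predSet H n ∪ succSet H n ∧ p ∉ D)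
    (h1D : 1 ∉ D) (h1P : 1 ∉ P) (h1 : side 1) (hnD : n ∉ D) (hnP : n ∉ P) (hn : ¬ side n)
    (hpivot : ∀ p ∈ P, ∀ j ∈ predSet H n ∪ succSet H n, j ∉ D → ¬ H.Adj p j)
    (hside : ∀ i ∈ predSet H n ∪ succSet H n, ∀ j ∈ predSet H n ∪ succSet H n, i ∉ D → j ∉ D →
      i ∉ P → j ∉ P → side i → ¬ side j → ¬ H.Adj i j) :
    t * (2 + #P) ≤ #(gapSet H n) + 1 + #(predSet H n ∩ succSet H n) + #D := by
  classical
  have h3 := hT.three_le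
  set K := (predSet H n ∪ succSet H n) \ D with hK
  set col : ℕ → ℕ := fun i => if i ∈ P then i else if side i then 1 else n with hcol
  have h1K : 1 ∈ K := mem_sdiff.2 ⟨mem_union_left _ hT.one_mem_predSet, h1D⟩
  have hnK : n ∈ K := mem_sdiff.2 ⟨mem_union_right _ hT.last_mem_succSet, hnD⟩
  have hsub : insert 1 (insert n P) ⊆ K.image col := by
    intro i hi
    rcases mem_insert.1 hi with rfl | hi
    · exact mem_image.2 ⟨1, h1K, by simp [hcol, h1P, h1]⟩
    rcases mem_insert.1 hi with rfl | hi
    · exact mem_image.2 ⟨i, hnK, by simp [hcol, hnP, hn]⟩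
    · exact mem_image.2 ⟨i, mem_sdiff.2 (hP i hi), by simp [hcol, hi]⟩
  have hcard : #P + 2 ≤ #(K.image col) := by
    have h := card_le_card hsub
    rwa [card_insert_of_notMem, card_insert_of_notMem hnP] at h
    rw [mem_insert]
    rintro (h | h)
    · omega
    · exact h1P h
  have htough := hT.tough K col ?_ ?_ (by omega)
  · have hle : t * (2 + #P) ≤ t * #(K.image col) := by
      have h4 := hT.four_le
      have : ((#P + 2 : ℕ) : ℚ) ≤ #(K.image col) := by exact_mod_cast hcard
      push_cast at this
      nlinarith
    have hKc : #(predSet H n) + #(succSet H n) ≤ #K + #(predSet H n ∩ succSet H n) + #D := by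
      have h := card_union_add_card_inter (predSet H n) (succSet H n)
      have h' : _ ≤ #K := le_card_sdiff D (predSet H n ∪ succSet H n)
      omega
    have hg := hT.card_gapSet
    have hn' : (n : ℚ) ≤ #(gapSet H n) + 1 + #K + #(predSet H n ∩ succSet H n) + #D := by
      have : n ≤ #(gapSet H n) + 1 + #K + #(predSet H n ∩ succSet H n) + #D := by omega
      exact_mod_cast this
    linarith
  · exact sdiff_subset.trans (union_subset predSet_subset succSet_subset)
  · intro i hi j hj hij
    obtain ⟨hi, hiD⟩ := mem_sdiff.1 hi
    obtain ⟨hj, hjD⟩ := mem_sdiff.1 hj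
    have hiP : i ∉ P := fun h => hpivot i h j hj hjD hij
    have hjP : j ∉ P := fun h => hpivot j h i hi hiD hij.symm
    have hs : side i ↔ side j := by
      by_contra hne
      rcases not_iff.1 hne with h
      by_cases hsi : side i
      · exact hside i hi j hj hiD hjD hiP hjP hsi (fun h' => (h.2 h') hsi) hij
      · exact hside j hj i hi hjD hiD hjP hiP (h.1 hsi) hsi hij.symm
    simp only [hcol, hiP, hjP, if_false, hs]

end ToughPath

end Counting

section Cases

variable {n : ℕ} {H : SimpleGraph ℕ} {t : ℚ}

theorem NonclosingPath.bounds_of_mem_strayPred (hP : NonclosingPath n H) {f : ℕ}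
    (hf : f ∈ strayPred H n) : 1 < f ∧ f + 1 < n := by
  obtain ⟨hA, -, h1, -⟩ := mem_strayPred.1 hf
  have := hP.add_two_le_of_mem_predSet hA
  have := mem_predSet.1 hA
  omega

theorem NonclosingPath.bounds_of_mem_straySucc (hP : NonclosingPath n H) {m : ℕ}
    (hm : m ∈ straySucc H n) : 2 < m ∧ m < n := by
  obtain ⟨hB, -, hn, -⟩ := mem_straySucc.1 hm
  have := hP.three_le_of_mem_succSet hB
  have := mem_succSet.1 hB
  omega

theorem card_straySucc_lt_add_card_strayPred_gt_le (p : ℕ) :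
    #{m ∈ straySucc H n | m < p} + #{f ∈ strayPred H n | p < f} ≤ #(gapSet H n) := by
  rw [← card_image_of_injective {m ∈ straySucc H n | m < p} (add_left_injective 1),
    ← card_union_of_disjoint]
  · refine card_le_card (union_subset (fun i hi => ?_) ?_)
    · obtain ⟨m, hm, rfl⟩ := mem_image.1 hi
      exact succ_mem_gapSet (mem_filter.1 hm).1
    · exact (filter_subset _ _).trans strayPred_subset_gapSet
  · rw [disjoint_left]
    intro i hi hi'
    obtain ⟨m, hm, rfl⟩ := mem_image.1 hi
    have := (mem_filter.1 hm).2
    have := (mem_filter.1 hi').2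
    omega

namespace ToughPath

theorem bridgedSucc_nonempty (hT : ToughPath t n H) (hW : predSet H n ∩ succSet H n = ∅) :
    (bridgedSucc H n).Nonempty := by
  by_contra hU
  rw [not_nonempty_iff_eq_empty] at hU
  have hM := fun m hm => hT.bounds_of_mem_straySucc (m := m) hm
  have h := hT.cut_le (straySucc H n) ∅ (· ∈ predSet H n) (by simp)
    (fun h => by have := hM _ h; omega) (by simp) hT.one_mem_predSet
    (fun h => by have := hM _ h; omega) (by simp)
    (fun h => by have := hT.add_two_le_of_mem_predSet h; omega) (by simp) ?_
  · have hM : (#(straySucc H n) : ℚ) ≤ #(gapSet H n) := by exact_mod_cast card_straySucc_le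
    have := hT.card_gapSet_le
    simp only [hW, card_empty] at h
    push_cast at h
    linarith
  · intro i _ j hj _ hjD _ _ hi hjA
    have hjB := (mem_union.1 hj).resolve_left hjA
    exact hT.not_adj_of_notMem_bridgedSucc hjB hjA hjD (by simp [hW]) (by simp [hU]) hi

theorem inter_nonempty (hT : ToughPath t n H) : (predSet H n ∩ succSet H n).Nonempty := by
  by_contra hW
  rw [not_nonempty_iff_eq_empty] at hW
  obtain ⟨p, hp⟩ := hT.bridgedSucc_nonempty hW
  have hpM := bridgedSucc_subset hp
  obtain ⟨hpB, -, -, hpA⟩ := mem_straySucc.1 hpM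
  have hpiv := hT.isPivot_of_mem_bridgedSucc hp
  have hp2 := hpiv.two_lt
  have hpn := hpiv.lt_pred
  have hM := fun m hm => hT.bounds_of_mem_straySucc (m := m) hm
  have hF := fun f hf => hT.bounds_of_mem_strayPred (f := f) hf
  set L := {m ∈ straySucc H n | m < p} with hL
  set R := {f ∈ strayPred H n | p < f} with hR
  set D := L ∪ L.image (· - 1) ∪ {p - 1} ∪ R ∪ R.image (· + 1) with hD
  have hcard : #D ≤ 2 * #(gapSet H n) + 1 := by
    have h : #L + #R ≤ _ := card_straySucc_lt_add_card_strayPred_gt_le p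
    have h1 : #(L.image (· - 1)) ≤ #L := card_image_le
    have h2 : #(R.image (· + 1)) ≤ #R := card_image_le
    have h3 : #D ≤ _ := card_union_le (L ∪ L.image (· - 1) ∪ {p - 1} ∪ R) (R.image (· + 1))
    have h4 := card_union_le (L ∪ L.image (· - 1) ∪ {p - 1}) R
    have h5 := card_union_le (L ∪ L.image (· - 1)) {p - 1}
    have h6 := card_union_le L (L.image (· - 1))
    rw [card_singleton] at h5
    omega
  have hmem : ∀ i, i ∉ D → (i ∈ straySucc H n → p ≤ i) ∧ (i + 1 ∈ straySucc H n → p ≤ i + 1) ∧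
      i ≠ p - 1 ∧ (i ∈ strayPred H n → i ≤ p) ∧ (i - 1 ∈ strayPred H n → i - 1 ≤ p) := by
    intro i hi
    simp only [hD, hL, hR, mem_union, mem_image, mem_filter, mem_singleton, not_or,
      not_exists, not_and] at hi
    obtain ⟨⟨⟨⟨h1, h2⟩, h3⟩, h4⟩, h5⟩ := hi
    refine ⟨fun h => by simpa using h1 h, fun h => ?_, h3, fun h => by simpa using h4 h,
      fun h => ?_⟩
    · by_contra hlt
      exact h2 (i + 1) ⟨h, by omega⟩ (by simp)
    · by_contra hlt
      exact h5 (i - 1) ⟨h, by omega⟩ (by omega)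
  have hpred : ∀ k ∈ predSet H n, k ∉ D → p < k → k ≤ 2 ∨ 1 < k ∧ H.Adj 1 (k - 1) := by
    intro k hk hkD hpk
    obtain ⟨-, -, -, h1, h2⟩ := hmem k hkD
    refine pred_of_notMem_strayPred hk (fun h => ?_) (fun h => ?_) (by simp [hW]) (fun h => ?_)
    · exact (eq_empty_iff_forall_notMem.1 hW) k (mem_inter.2 ⟨hk, h⟩)
    · have := h1 h
      omega
    · have := h2 h
      rw [show k - 1 = p by omega] at h
      exact hpA (mem_strayPred.1 h).1
  have hsucc : ∀ l ∈ succSet H n, l ∉ D → l < p → n ≤ l + 1 ∨ l < n ∧ H.Adj n (l + 1) := by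
    intro l hl hlD hlp
    obtain ⟨h1, h2, h3, -, -⟩ := hmem l hlD
    refine succ_of_notMem_straySucc hl (fun h => ?_) (fun h => ?_) (by simp [hW]) (fun h => ?_)
    · exact (eq_empty_iff_forall_notMem.1 hW) l (mem_inter.2 ⟨h, hl⟩)
    · have := h1 h
      omega
    · have := h2 h
      omega
  have hDmem : ∀ i ∈ D, 1 < i ∧ i < n := by
    intro i hi
    simp only [hD, hL, hR, mem_union, mem_image, mem_filter, mem_singleton] at hi
    rcases hi with (((⟨h, -⟩ | ⟨m, ⟨h, -⟩, rfl⟩) | rfl) | ⟨h, -⟩) | ⟨f, ⟨h, -⟩, rfl⟩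
    · have := hM _ h; omega
    · have := hM _ h; omega
    · omega
    · have := hF _ h; omega
    · have := hF _ h; omega
  have hpD : p ∉ D := by
    simp only [hD, hL, hR, mem_union, mem_image, mem_filter, mem_singleton, not_or,
      not_exists, not_and]
    refine ⟨⟨⟨⟨fun _ => lt_irrefl p, fun m hm hmp => ?_⟩, by omega⟩, fun _ => lt_irrefl p⟩,
      fun f hf hfp => ?_⟩ <;> omega
  have h := hT.cut_le D {p} (· ∈ predSet H n)
    (fun q hq => by
      rw [mem_singleton] at hq
      rw [hq]
      exact ⟨mem_union_right _ hpB, hpD⟩)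
    (fun h => by have := hDmem _ h; omega) (by simp; omega) hT.one_mem_predSet
    (fun h => by have := hDmem _ h; omega) (by simp; omega)
    (fun h => by have := hT.add_two_le_of_mem_predSet h; omega) ?_ ?_
  · have hD' : (#D : ℚ) ≤ 2 * #(gapSet H n) + 1 := by exact_mod_cast hcard
    have := hT.card_gapSet_le
    simp only [hW, card_empty, card_singleton] at h
    push_cast at h
    linarith
  · intro q hq j hj hjD
    rw [mem_singleton] at hq
    subst hq
    rcases mem_union.1 hj with hj | hj
    · rcases lt_trichotomy j q with hlt | rfl | hgt
      · exact hpiv.not_adj_pred j hj (Or.inl hlt)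
      · exact H.irrefl
      · rcases hpred j hj hjD hgt with h | h
        · omega
        · exact hpiv.not_adj_pred j hj (Or.inr h)
    · rcases lt_trichotomy j q with hlt | rfl | hgt
      · rcases hsucc j hj hjD hlt with h | h
        · omega
        · exact hpiv.not_adj_succ j hj (Or.inr h)
      · exact H.irrefl
      · exact hpiv.not_adj_succ j hj (Or.inl hgt)
  · intro i _ j hj hiD hjD _ hjP hi hjA
    rw [mem_singleton] at hjP
    have hjB := (mem_union.1 hj).resolve_left hjA
    rcases lt_trichotomy i j with hlt | rfl | hgt
    · exact hT.not_adj_of_mem_of_lt hi hjB hlt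
    · exact H.irrefl
    · rcases lt_or_gt_of_ne hjP with hjp | hpj
      · exact hT.not_adj_of_succ hi hjB (hsucc j hjB hjD hjp)
      · exact hT.not_adj_of_pred hi hjB (hpred i hi hiD (hpj.trans hgt))

end ToughPath

end Cases

section Cases

variable {n : ℕ} {H : SimpleGraph ℕ} {t : ℚ}

namespace ToughPath

theorem three_mul_le_of_inter_eq_singleton (hT : ToughPath t n H) {w : ℕ}
    (hW : predSet H n ∩ succSet H n = {w}) :
    3 * t ≤ #(gapSet H n) + 4 + #{m ∈ straySucc H n | m < w} +
      #{m ∈ straySucc H n | m < w ∧ m ∉ bridgedSucc H n} +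
      #{f ∈ strayPred H n | w < f} + #{f ∈ bridgedPred H n | w < f} := by
  classical
  have hwW : w ∈ predSet H n ∩ succSet H n := by simp [hW]
  obtain ⟨hwA, hwB⟩ := mem_inter.1 hwW
  have hW' : ∀ i, i ≠ w → i ∉ predSet H n ∩ succSet H n := by simp [hW]
  have hpiv := hT.isPivot_of_mem_inter hwW
  have hw2 := hpiv.two_lt
  have hwn := hpiv.lt_pred
  have hM := fun m hm => hT.bounds_of_mem_straySucc (m := m) hm
  have hF := fun f hf => hT.bounds_of_mem_strayPred (f := f) hf
  set L := {m ∈ straySucc H n | m < w} with hL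
  set L' := {m ∈ straySucc H n | m < w ∧ m ∉ bridgedSucc H n} with hL'
  set R := {f ∈ strayPred H n | w < f} with hR
  set R' := {f ∈ bridgedPred H n | w < f} with hR'
  set D := L.image (· - 1) ∪ L' ∪ {w - 1, w + 1} ∪ R ∪ R'.image (· + 1) with hD
  have hcard : #D ≤ #L + #L' + 2 + #R + #R' := by
    have h1 : #(L.image (· - 1)) ≤ #L := card_image_le
    have h2 : #(R'.image (· + 1)) ≤ #R' := card_image_le
    have h3 : #D ≤ _ := card_union_le (L.image (· - 1) ∪ L' ∪ {w - 1, w + 1} ∪ R) (R'.image (· + 1))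
    have h4 := card_union_le (L.image (· - 1) ∪ L' ∪ {w - 1, w + 1}) R
    have h5 := card_union_le (L.image (· - 1) ∪ L') {w - 1, w + 1}
    have h6 := card_union_le (L.image (· - 1)) L'
    have h7 : #{w - 1, w + 1} ≤ 2 := card_le_two
    omega
  have hmem : ∀ i, i ∉ D → (i ∈ straySucc H n → i < w → i ∈ bridgedSucc H n) ∧
      (i + 1 ∈ straySucc H n → w ≤ i + 1) ∧ i ≠ w - 1 ∧ i ≠ w + 1 ∧
      (i ∈ strayPred H n → i ≤ w) ∧ (i - 1 ∈ bridgedPred H n → i - 1 ≤ w) := by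
    intro i hi
    simp only [hD, hL, hL', hR, hR', mem_union, mem_image, mem_filter, mem_singleton, mem_insert,
      not_or, not_exists, not_and, not_not] at hi
    obtain ⟨⟨⟨⟨h1, h2⟩, h3, h4⟩, h5⟩, h6⟩ := hi
    refine ⟨h2, fun h => ?_, h3, h4, fun h => by simpa using h5 h, fun h => ?_⟩
    · by_contra hlt
      exact h1 (i + 1) ⟨h, by omega⟩ (by simp)
    · by_contra hlt
      exact h6 (i - 1) ⟨h, by omega⟩ (by omega)
  have hpred : ∀ k ∈ predSet H n, k ∉ D → w < k → ∀ l ∈ succSet H n, ¬ H.Adj k l := by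
    intro k hk hkD hwk l hl
    obtain ⟨-, -, -, h1, h2, h3⟩ := hmem k hkD
    refine hT.not_adj_of_notMem_bridgedPred hk (fun h => ?_) (fun h => ?_) (hW' _ (by omega))
      (fun h => ?_) hl
    · exact hW' k (by omega) (mem_inter.2 ⟨hk, h⟩)
    · have := h2 h
      omega
    · have := h3 h
      omega
  have hsucc : ∀ l ∈ succSet H n, l ∉ D → l < w → l ∉ bridgedSucc H n →
      n ≤ l + 1 ∨ l < n ∧ H.Adj n (l + 1) := by
    intro l hl hlD hlw hlU
    obtain ⟨h1, h2, h3, -, -⟩ := hmem l hlD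
    refine succ_of_notMem_straySucc hl (fun h => ?_) (fun h => ?_) (hW' _ (by omega)) (fun h => ?_)
    · exact hW' l (by omega) (mem_inter.2 ⟨h, hl⟩)
    · exact hlU (h1 h hlw)
    · have := h2 h
      omega
  have hDmem : ∀ i ∈ D, 1 < i ∧ i < n := by
    intro i hi
    simp only [hD, hL, hL', hR, hR', mem_union, mem_image, mem_filter, mem_singleton,
      mem_insert] at hi
    rcases hi with (((⟨m, ⟨h, -⟩, rfl⟩ | ⟨h, -⟩) | rfl | rfl) | ⟨h, -⟩) | ⟨f, ⟨h, -⟩, rfl⟩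
    · have := hM _ h; omega
    · have := hM _ h; omega
    · omega
    · omega
    · have := hF _ h; omega
    · have := hF _ (bridgedPred_subset h); omega
  have hwD : w ∉ D := by
    simp only [hD, hL, hL', hR, hR', mem_union, mem_image, mem_filter, mem_singleton, mem_insert,
      not_or, not_exists, not_and]
    refine ⟨⟨⟨⟨fun m hm hmw => ?_, fun _ h => (lt_irrefl w h).elim⟩, by omega, by omega⟩,
      fun _ => lt_irrefl w⟩, fun f hf hfw => ?_⟩ <;> omega
  have h := hT.cut_le D {w} (fun i => i ∈ predSet H n ∨ i ∈ bridgedSucc H n ∧ i < w)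
    (fun q hq => by
      rw [mem_singleton] at hq
      rw [hq]
      exact ⟨mem_union_right _ hwB, hwD⟩)
    (fun h => by have := hDmem _ h; omega) (by simp; omega) (Or.inl hT.one_mem_predSet)
    (fun h => by have := hDmem _ h; omega) (by simp; omega) ?_ ?_ ?_
  · have hD' : (#D : ℚ) ≤ #L + #L' + 2 + #R + #R' := by exact_mod_cast hcard
    simp only [hW, card_singleton] at h
    push_cast at h
    linarith
  · rintro (h | h)
    · have := hT.add_two_le_of_mem_predSet h
      omega
    · omega
  · intro q hq j hj hjD
    rw [mem_singleton] at hq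
    subst hq
    rcases mem_union.1 hj with hj | hj
    · rcases lt_trichotomy j q with hlt | rfl | hgt
      · exact hpiv.not_adj_pred j hj (Or.inl hlt)
      · exact H.irrefl
      · exact fun h => hpred j hj hjD hgt q hwB h.symm
    · rcases lt_trichotomy j q with hlt | rfl | hgt
      · by_cases hjU : j ∈ bridgedSucc H n
        · exact fun h =>
            (hT.isPivot_of_mem_bridgedSucc hjU).not_adj_succ q hwB (Or.inl hlt) h.symm
        · exact hT.not_adj_of_succ hwA hj (hsucc j hj hjD hlt hjU)
      · exact H.irrefl
      · exact hpiv.not_adj_succ j hj (Or.inl hgt)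
  · intro i _ j hj hiD hjD _ hjP hi hjs
    rw [mem_singleton] at hjP
    rw [not_or, not_and] at hjs
    have hjB := (mem_union.1 hj).resolve_left hjs.1
    rcases hi with hi | ⟨hi, hiw⟩
    · rcases lt_trichotomy i j with hlt | rfl | hgt
      · exact hT.not_adj_of_mem_of_lt hi hjB hlt
      · exact H.irrefl
      · rcases lt_or_gt_of_ne hjP with hjw | hwj
        · exact hT.not_adj_of_succ hi hjB (hsucc j hjB hjD hjw fun h => hjs.2 h hjw)
        · exact hpred i hi hiD (hwj.trans hgt) j hjB
    · have hipiv := hT.isPivot_of_mem_bridgedSucc hi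
      rcases lt_trichotomy i j with hlt | rfl | hgt
      · exact hipiv.not_adj_succ j hjB (Or.inl hlt)
      · exact H.irrefl
      · have hjw := hgt.trans hiw
        rcases hsucc j hjB hjD hjw fun h => hjs.2 h hjw with h | h
        · omega
        · exact hipiv.not_adj_succ j hjB (Or.inr h)

theorem card_inter_ne_one (hT : ToughPath t n H) : #(predSet H n ∩ succSet H n) ≠ 1 := by
  classical
  intro h
  obtain ⟨w, hW⟩ := card_eq_one.1 h
  have hwW : w ∈ predSet H n ∩ succSet H n := by simp [hW]
  have hwn := mem_Icc.1 (predSet_subset (mem_inter.1 hwW).1)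
  have hW' : predSet (_root_.reflect n H) n ∩ succSet (_root_.reflect n H) n = {n + 1 - w} := by
    refine (eq_of_subset_of_card_le (singleton_subset_iff.2 ?_) ?_).symm
    · rw [mem_inter, mem_predSet_reflect (by omega) (by omega),
        mem_succSet_reflect (by omega) (by omega), show n + 1 - (n + 1 - w) = w by omega,
        and_comm, ← mem_inter]
      exact hwW
    · rw [card_inter_reflect, h, card_singleton]
  have h1 := hT.three_mul_le_of_inter_eq_singleton hW
  have h2 := hT.reflect.three_mul_le_of_inter_eq_singleton hW'
  have e1 : #{m ∈ straySucc (_root_.reflect n H) n | m < n + 1 - w} =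
      #{f ∈ strayPred H n | w < f} := by
    refine card_eq_of_reflect ((filter_subset _ _).trans straySucc_subset)
      ((filter_subset _ _).trans strayPred_subset) fun i hi => ?_
    have hi' := mem_Icc.1 hi
    rw [mem_filter, mem_filter, mem_straySucc_reflect hi'.1 hi'.2,
      show i < n + 1 - w ↔ w < n + 1 - i by omega]
  have e2 : #{m ∈ straySucc (_root_.reflect n H) n |
      m < n + 1 - w ∧ m ∉ bridgedSucc (_root_.reflect n H) n} =
      #{f ∈ strayPred H n | w < f ∧ f ∉ bridgedPred H n} := by
    refine card_eq_of_reflect ((filter_subset _ _).trans straySucc_subset)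
      ((filter_subset _ _).trans strayPred_subset) fun i hi => ?_
    have hi' := mem_Icc.1 hi
    rw [mem_filter, mem_filter, mem_straySucc_reflect hi'.1 hi'.2,
      mem_bridgedSucc_reflect hi'.1 hi'.2, show i < n + 1 - w ↔ w < n + 1 - i by omega]
  have e3 : #{f ∈ strayPred (_root_.reflect n H) n | n + 1 - w < f} =
      #{m ∈ straySucc H n | m < w} := by
    refine card_eq_of_reflect ((filter_subset _ _).trans strayPred_subset)
      ((filter_subset _ _).trans straySucc_subset) fun i hi => ?_
    have hi' := mem_Icc.1 hi
    rw [mem_filter, mem_filter, mem_strayPred_reflect hi'.1 hi'.2,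
      show n + 1 - w < i ↔ n + 1 - i < w by omega]
  have e4 : #{f ∈ bridgedPred (_root_.reflect n H) n | n + 1 - w < f} =
      #{m ∈ bridgedSucc H n | m < w} := by
    refine card_eq_of_reflect
      ((filter_subset _ _).trans (bridgedPred_subset.trans strayPred_subset))
      ((filter_subset _ _).trans (bridgedSucc_subset.trans straySucc_subset)) fun i hi => ?_
    have hi' := mem_Icc.1 hi
    rw [mem_filter, mem_filter, mem_bridgedPred_reflect hi'.1 hi'.2,
      show n + 1 - w < i ↔ n + 1 - i < w by omega]
  have s1 : #{m ∈ straySucc H n | m < w ∧ m ∉ bridgedSucc H n} +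
      #{m ∈ bridgedSucc H n | m < w} = #{m ∈ straySucc H n | m < w} := by
    rw [← card_filter_add_card_filter_not (s := {m ∈ straySucc H n | m < w})
      (p := fun m => m ∈ bridgedSucc H n), filter_filter, filter_filter, add_comm]
    congr 2
    ext m
    simp only [mem_filter]
    exact ⟨fun h => ⟨bridgedSucc_subset h.1, h.2, h.1⟩, fun h => ⟨h.2.2, h.2.1⟩⟩
  have s2 : #{f ∈ strayPred H n | w < f ∧ f ∉ bridgedPred H n} +
      #{f ∈ bridgedPred H n | w < f} = #{f ∈ strayPred H n | w < f} := by
    rw [← card_filter_add_card_filter_not (s := {f ∈ strayPred H n | w < f})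
      (p := fun f => f ∈ bridgedPred H n), filter_filter, filter_filter, add_comm]
    congr 2
    ext f
    simp only [mem_filter]
    exact ⟨fun h => ⟨bridgedPred_subset h.1, h.2, h.1⟩, fun h => ⟨h.2.2, h.2.1⟩⟩
  rw [e1, e2, e3, e4, hT.card_gapSet_reflect] at h2
  have hz := card_straySucc_lt_add_card_strayPred_gt_le (H := H) (n := n) w
  have ht := hT.card_gapSet_le
  have h4 := hT.four_le
  rw [← s1] at h1 h2 hz
  rw [← s2] at h1 h2 hz
  have hz' := (Nat.cast_le (α := ℚ)).2 hz
  push_cast at h1 h2 hz'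
  linarith

end ToughPath

end Cases

section Cases

variable {n : ℕ} {H : SimpleGraph ℕ} {t : ℚ}

theorem NonclosingPath.succ_ne (hP : NonclosingPath n H) {k l : ℕ} (hk : k ∈ predSet H n)
    (hl : l ∈ succSet H n) : k + 1 ≠ l := by
  rintro rfl
  have hk' := mem_predSet.1 hk
  exact hP.false_of_crossing hk'.1 hk'.2.1 hk'.2.2 (mem_succSet.1 hl).2.2

namespace ToughPath

/-- If no stray element is bridged, at most one of them has to be kept out of the cut, namely
one without neighbours in `predSet ∩ succSet`. -/
theorem mul_le_of_bridged_eq_empty (hT : ToughPath t n H) (hF : bridgedPred H n = ∅)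
    (hM : bridgedSucc H n = ∅) (e : ℕ)
    (he : e ∈ straySucc H n ∨ e ∈ strayPred H n →
      ∀ w ∈ predSet H n ∩ succSet H n, ¬ H.Adj w e) :
    t * (2 + #(predSet H n ∩ succSet H n)) ≤ #(gapSet H n) + 1 + 3 * #(predSet H n ∩ succSet H n) +
      #((straySucc H n).erase e) + #((strayPred H n).erase e) := by
  set W := predSet H n ∩ succSet H n with hW
  set D := (straySucc H n).erase e ∪ (strayPred H n).erase e ∪ W.image (· - 1) ∪
    W.image (· + 1) with hD
  have hWb : ∀ w ∈ W, 3 ≤ w ∧ w + 2 ≤ n := fun w hw =>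
    ⟨hT.three_le_of_mem_succSet (mem_inter.1 hw).2, hT.add_two_le_of_mem_predSet (mem_inter.1 hw).1⟩
  have hcard : #D ≤ #((straySucc H n).erase e) + #((strayPred H n).erase e) + 2 * #W := by
    have h1 : #(W.image (· - 1)) ≤ #W := card_image_le
    have h2 : #(W.image (· + 1)) ≤ #W := card_image_le
    have h3 : #D ≤ _ := card_union_le ((straySucc H n).erase e ∪ (strayPred H n).erase e ∪
      W.image (· - 1)) (W.image (· + 1))
    have h4 := card_union_le ((straySucc H n).erase e ∪ (strayPred H n).erase e) (W.image (· - 1))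
    have h5 := card_union_le ((straySucc H n).erase e) ((strayPred H n).erase e)
    omega
  have hmem : ∀ i, i ∉ D → (i ∈ straySucc H n → i = e) ∧ (i ∈ strayPred H n → i = e) ∧
      i + 1 ∉ W ∧ i - 1 ∉ W := by
    intro i hi
    simp only [hD, mem_union, mem_image, mem_erase, not_or, not_exists, not_and] at hi
    obtain ⟨⟨⟨h1, h2⟩, h3⟩, h4⟩ := hi
    refine ⟨fun h => ?_, fun h => ?_, fun h => h3 _ h (by simp), fun h => ?_⟩
    · by_contra hne
      exact h1 hne h
    · by_contra hne
      exact h2 hne h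
    · have := hWb _ h
      exact h4 _ h (by omega)
  have hDmem : ∀ i ∈ D, 1 < i ∧ i < n := by
    intro i hi
    simp only [hD, mem_union, mem_image, mem_erase] at hi
    rcases hi with ((⟨-, h⟩ | ⟨-, h⟩) | ⟨w, h, rfl⟩) | ⟨w, h, rfl⟩
    · have := hT.bounds_of_mem_straySucc h; omega
    · have := hT.bounds_of_mem_strayPred h; omega
    · have := hWb _ h; omega
    · have := hWb _ h; omega
  have hWD : ∀ w ∈ W, w ∉ D := by
    intro w hw hwD
    obtain ⟨hwA, hwB⟩ := mem_inter.1 hw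
    simp only [hD, mem_union, mem_image, mem_erase] at hwD
    rcases hwD with ((⟨-, h⟩ | ⟨-, h⟩) | ⟨u, h, hu⟩) | ⟨u, h, hu⟩
    · exact (mem_straySucc.1 h).2.2.2 hwA
    · exact (mem_strayPred.1 h).2.2.2 hwB
    · have := hWb _ h
      exact hT.succ_ne hwA (mem_inter.1 h).2 (by omega)
    · exact hT.succ_ne (mem_inter.1 h).1 hwB hu
  have hpred : ∀ i ∈ predSet H n, i ∉ succSet H n → i ∉ D → i ∉ strayPred H n →
      ∀ l ∈ succSet H n, ¬ H.Adj i l := fun i hi hiB hiD hiF l hl =>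
    hT.not_adj_of_notMem_bridgedPred hi hiB hiF (hmem i hiD).2.2.2 (by simp [hF]) hl
  have hsucc : ∀ j ∈ succSet H n, j ∉ predSet H n → j ∉ D → j ∉ straySucc H n →
      ∀ k ∈ predSet H n, ¬ H.Adj k j := fun j hj hjA hjD hjM k hk =>
    hT.not_adj_of_notMem_bridgedSucc hj hjA hjM (hmem j hjD).2.2.1 (by simp [hM]) hk
  have h := hT.cut_le D W (· ∈ predSet H n)
    (fun w hw => ⟨mem_union_left _ (mem_inter.1 hw).1, hWD w hw⟩)
    (fun h => by have := hDmem _ h; omega) (fun h => by have := hWb _ h; omega)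
    hT.one_mem_predSet
    (fun h => by have := hDmem _ h; omega) (fun h => by have := hWb _ h; omega)
    (fun h => by have := hT.add_two_le_of_mem_predSet h; omega) ?_ ?_
  · have hD' : (#D : ℚ) ≤ #((straySucc H n).erase e) + #((strayPred H n).erase e) + 2 * #W := by
      exact_mod_cast hcard
    linarith
  · intro w hw j hj hjD hadj
    obtain ⟨hwA, hwB⟩ := mem_inter.1 hw
    by_cases hjA : j ∈ predSet H n
    · by_cases hjB : j ∈ succSet H n
      · rcases lt_trichotomy w j with hlt | rfl | hgt
        · exact hT.not_adj_of_mem_of_lt hwA hjB hlt hadj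
        · exact H.irrefl hadj
        · exact hT.not_adj_of_mem_of_lt hjA hwB hgt hadj.symm
      · by_cases hjF : j ∈ strayPred H n
        · obtain rfl := (hmem j hjD).2.1 hjF
          exact he (Or.inr hjF) w hw hadj
        · exact hpred j hjA hjB hjD hjF w hwB hadj.symm
    · have hjB := (mem_union.1 hj).resolve_left hjA
      by_cases hjM : j ∈ straySucc H n
      · obtain rfl := (hmem j hjD).1 hjM
        exact he (Or.inl hjM) w hw hadj
      · exact hsucc j hjB hjA hjD hjM w hwA hadj
  · intro i _ j hj hiD hjD hiW _ hi hjA hadj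
    have hjB := (mem_union.1 hj).resolve_left hjA
    by_cases hiF : i ∈ strayPred H n
    · refine hsucc j hjB hjA hjD (fun hjM => hjA ?_) i hi hadj
      rwa [(hmem j hjD).1 hjM, ← (hmem i hiD).2.1 hiF]
    · exact hpred i hi (fun h => hiW (mem_inter.2 ⟨hi, h⟩)) hiD hiF j hjB hadj

theorem bridged_nonempty (hT : ToughPath t n H) (hc : 2 ≤ #(predSet H n ∩ succSet H n)) :
    (bridgedPred H n).Nonempty ∨ (bridgedSucc H n).Nonempty := by
  by_contra! hcon
  obtain ⟨hF, hM⟩ := hcon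
  have hz := hT.card_gapSet_le
  have ht4 := hT.four_le
  have hcM : (#(straySucc H n) : ℚ) ≤ #(gapSet H n) := by exact_mod_cast card_straySucc_le
  have hcF : (#(strayPred H n) : ℚ) ≤ #(gapSet H n) := by exact_mod_cast card_strayPred_le
  have h0 := hT.mul_le_of_bridged_eq_empty hF hM 0 (by
    rintro (h | h)
    · have := hT.bounds_of_mem_straySucc h; omega
    · have := hT.bounds_of_mem_strayPred h; omega)
  rw [erase_eq_of_notMem (fun h => by have := hT.bounds_of_mem_straySucc h; omega),
    erase_eq_of_notMem (fun h => by have := hT.bounds_of_mem_strayPred h; omega)] at h0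
  have hc' : (2 : ℚ) ≤ #(predSet H n ∩ succSet H n) := by exact_mod_cast hc
  obtain rfl : t = 4 := by nlinarith
  have hc2 : #(predSet H n ∩ succSet H n) = 2 := by
    refine le_antisymm ?_ hc
    have : (#(predSet H n ∩ succSet H n) : ℚ) ≤ 2 := by linarith
    exact_mod_cast this
  have hz3 : #(gapSet H n) ≤ 3 := by
    have : (#(gapSet H n) : ℚ) ≤ 3 := by linarith
    exact_mod_cast this
  rw [hc2] at h0
  have hsum : 9 ≤ #(gapSet H n) + #(straySucc H n) + #(strayPred H n) := by
    have : (9 : ℚ) ≤ #(gapSet H n) + #(straySucc H n) + #(strayPred H n) := by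
      push_cast at h0; linarith
    exact_mod_cast this
  have hM3 := card_straySucc_le (n := n) (H := H)
  have hF3 := card_strayPred_le (n := n) (H := H)
  have hcut : ∀ e, e ∈ straySucc H n ∨ e ∈ strayPred H n →
      ∃ w ∈ predSet H n ∩ succSet H n, H.Adj w e := by
    intro e he
    by_contra! hcon
    have h := hT.mul_le_of_bridged_eq_empty hF hM e fun _ => hcon
    have herase : #((straySucc H n).erase e) + #((strayPred H n).erase e) ≤ 5 := by
      have h1 := card_erase_le (s := straySucc H n) (a := e)
      have h2 := card_erase_le (s := strayPred H n) (a := e)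
      rcases he with he | he
      · have := card_erase_of_mem he
        omega
      · have := card_erase_of_mem he
        omega
    have herase' : (#((straySucc H n).erase e) : ℚ) + #((strayPred H n).erase e) ≤ 5 := by
      exact_mod_cast herase
    rw [hc2] at h
    push_cast at h
    linarith
  obtain ⟨m, hm⟩ : (straySucc H n).Nonempty := card_pos.1 (by omega)
  have hm' : m + 1 ∈ strayPred H n := by
    rw [eq_of_subset_of_card_le strayPred_subset_gapSet (by omega)]
    exact succ_mem_gapSet hm
  obtain ⟨b, hb, hmb⟩ := hcut m (Or.inl hm)
  obtain ⟨a, ha, hma⟩ := hcut (m + 1) (Or.inr hm')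
  obtain ⟨hbA, hbB⟩ := mem_inter.1 hb
  obtain ⟨haA, haB⟩ := mem_inter.1 ha
  obtain ⟨hmB, -, -, hmA⟩ := mem_straySucc.1 hm
  obtain ⟨hmA', -, -, hmB'⟩ := mem_strayPred.1 hm'
  have hb1 : m < b := by
    refine lt_of_not_ge fun hle => ?_
    rcases hle.lt_or_eq with h | rfl
    · exact hT.not_adj_of_mem_of_lt hbA hmB h hmb
    · exact hmA hbA
  have hb2 : b ≠ m + 1 := by
    rintro rfl
    exact hmB' hbB
  have ha1 : a < m + 1 := by
    refine lt_of_not_ge fun hle => ?_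
    rcases hle.lt_or_eq with h | rfl
    · exact hT.not_adj_of_mem_of_lt hmA' haB h hma.symm
    · exact hmB' haB
  have ha2 : a ≠ m := by
    rintro rfl
    exact hmA haA
  have haA' := mem_predSet.1 haA
  have hbB' := mem_succSet.1 hbB
  exact hT.not_adj_of_consecutive haA'.1 (by omega) (by omega) hbB'.2.1 haA'.2.2 hbB'.2.2
    hmb.symm hma.symm

theorem card_bridgedSucc_lt (hT : ToughPath t n H) (hc : 2 ≤ #(predSet H n ∩ succSet H n))
    (hU : (bridgedSucc H n).Nonempty) : #(bridgedSucc H n) < #(bridgedPred H n) := by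
  by_contra! hle
  set W := predSet H n ∩ succSet H n with hW
  set U := bridgedSucc H n with hUdef
  have hWb : ∀ w ∈ W, 3 ≤ w ∧ w + 2 ≤ n := fun w hw =>
    ⟨hT.three_le_of_mem_succSet (mem_inter.1 hw).2, hT.add_two_le_of_mem_predSet (mem_inter.1 hw).1⟩
  set D := (straySucc H n).image (· - 1) ∪ (straySucc H n \ U) ∪ strayPred H n ∪
    (bridgedPred H n).image (· + 1) ∪ W.image (· - 1) ∪ W.image (· + 1) with hD
  have hUM : #(straySucc H n \ U) + #U = #(straySucc H n) :=
    card_sdiff_add_card_eq_card bridgedSucc_subset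
  have hcard : #D ≤ 2 * #(straySucc H n) + #(strayPred H n) + 2 * #W := by
    have h1 : #(W.image (· - 1)) ≤ #W := card_image_le
    have h2 : #(W.image (· + 1)) ≤ #W := card_image_le
    have h3 : #((straySucc H n).image (· - 1)) ≤ #(straySucc H n) := card_image_le
    have h4 : #((bridgedPred H n).image (· + 1)) ≤ #(bridgedPred H n) := card_image_le
    have h5 : #D ≤ _ := card_union_le ((straySucc H n).image (· - 1) ∪ (straySucc H n \ U) ∪
      strayPred H n ∪ (bridgedPred H n).image (· + 1) ∪ W.image (· - 1)) (W.image (· + 1))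
    have h6 := card_union_le ((straySucc H n).image (· - 1) ∪ (straySucc H n \ U) ∪
      strayPred H n ∪ (bridgedPred H n).image (· + 1)) (W.image (· - 1))
    have h7 := card_union_le ((straySucc H n).image (· - 1) ∪ (straySucc H n \ U) ∪
      strayPred H n) ((bridgedPred H n).image (· + 1))
    have h8 := card_union_le ((straySucc H n).image (· - 1) ∪ (straySucc H n \ U)) (strayPred H n)
    have h9 := card_union_le ((straySucc H n).image (· - 1)) (straySucc H n \ U)
    omega
  have hmem : ∀ i, i ∉ D → (i ∈ straySucc H n → i ∈ U) ∧ i + 1 ∉ straySucc H n ∧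
      i ∉ strayPred H n ∧ i - 1 ∉ bridgedPred H n ∧ i + 1 ∉ W ∧ i - 1 ∉ W := by
    intro i hi
    simp only [hD, mem_union, mem_image, mem_sdiff, not_or, not_exists, not_and, not_not] at hi
    obtain ⟨⟨⟨⟨⟨h1, h2⟩, h3⟩, h4⟩, h5⟩, h6⟩ := hi
    refine ⟨h2, fun h => h1 _ h (by simp), h3, fun h => ?_, fun h => h5 _ h (by simp),
      fun h => ?_⟩
    · have := hT.bounds_of_mem_strayPred (bridgedPred_subset h)
      exact h4 _ h (by omega)
    · have := hWb _ h
      exact h6 _ h (by omega)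
  have hDmem : ∀ i ∈ D, 1 < i ∧ i < n := by
    intro i hi
    simp only [hD, mem_union, mem_image, mem_sdiff] at hi
    rcases hi with ((((⟨m, h, rfl⟩ | ⟨h, -⟩) | h) | ⟨f, h, rfl⟩) | ⟨w, h, rfl⟩) | ⟨w, h, rfl⟩
    · have := hT.bounds_of_mem_straySucc h; omega
    · have := hT.bounds_of_mem_straySucc h; omega
    · have := hT.bounds_of_mem_strayPred h; omega
    · have := hT.bounds_of_mem_strayPred (bridgedPred_subset h); omega
    · have := hWb _ h; omega
    · have := hWb _ h; omega
  have hpB : ∀ p ∈ W ∪ U, p ∈ succSet H n := by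
    intro p hp
    rcases mem_union.1 hp with hp | hp
    · exact (mem_inter.1 hp).2
    · exact (mem_straySucc.1 (bridgedSucc_subset hp)).1
  have hpiv : ∀ p ∈ W ∪ U, IsPivot n H p := by
    intro p hp
    rcases mem_union.1 hp with hp | hp
    · exact hT.isPivot_of_mem_inter hp
    · exact hT.isPivot_of_mem_bridgedSucc hp
  have hdisj : Disjoint W U := by
    rw [disjoint_left]
    intro i hiW hiU
    exact (mem_straySucc.1 (bridgedSucc_subset hiU)).2.2.2 (mem_inter.1 hiW).1
  have hPD : ∀ p ∈ W ∪ U, p ∉ D := by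
    intro p hp hpD
    have hpB := hpB p hp
    simp only [hD, mem_union, mem_image, mem_sdiff] at hpD
    rcases hpD with ((((⟨m, h, hm⟩ | ⟨h, hpU⟩) | h) | ⟨f, h, hf⟩) | ⟨w, h, hw⟩) | ⟨w, h, hw⟩
    · have := hT.bounds_of_mem_straySucc h
      obtain rfl : m = p + 1 := by omega
      have hmB := (mem_straySucc.1 h).1
      rcases mem_union.1 hp with hp | hp
      · exact hT.succ_ne (mem_inter.1 hp).1 hmB rfl
      · exact (mem_straySucc.1 (bridgedSucc_subset hp)).2.1 (mem_succSet.1 hmB).2.2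
    · rcases mem_union.1 hp with hp | hp
      · exact (mem_straySucc.1 h).2.2.2 (mem_inter.1 hp).1
      · exact hpU hp
    · exact (mem_strayPred.1 h).2.2.2 hpB
    · exact hT.succ_ne (mem_strayPred.1 (bridgedPred_subset h)).1 hpB hf
    · have := hWb _ h
      obtain rfl : w = p + 1 := by omega
      have hwB := (mem_inter.1 h).2
      rcases mem_union.1 hp with hp | hp
      · exact hT.succ_ne (mem_inter.1 hp).1 hwB rfl
      · exact (mem_straySucc.1 (bridgedSucc_subset hp)).2.1 (mem_succSet.1 hwB).2.2
    · exact hT.succ_ne (mem_inter.1 h).1 hpB hw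
  have hpred : ∀ i ∈ predSet H n, i ∉ D → i ∉ W → ∀ l ∈ succSet H n, ¬ H.Adj i l := by
    intro i hi hiD hiW l hl
    obtain ⟨-, -, h1, h2, -, h3⟩ := hmem i hiD
    exact hT.not_adj_of_notMem_bridgedPred hi (fun h => hiW (mem_inter.2 ⟨hi, h⟩)) h1 h3 h2 hl
  have hsucc : ∀ j ∈ succSet H n, j ∉ predSet H n → j ∉ D → j ∉ U →
      n ≤ j + 1 ∨ j < n ∧ H.Adj n (j + 1) := by
    intro j hj hjA hjD hjU
    obtain ⟨h1, h2, -, -, h3, -⟩ := hmem j hjD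
    exact succ_of_notMem_straySucc hj hjA (fun h => hjU (h1 h)) h3 h2
  have h := hT.cut_le D (W ∪ U) (· ∈ predSet H n)
    (fun p hp => ⟨mem_union_right _ (hpB p hp), hPD p hp⟩)
    (fun h => by have := hDmem _ h; omega) (fun h => by have := (hpiv _ h).two_lt; omega)
    hT.one_mem_predSet
    (fun h => by have := hDmem _ h; omega) (fun h => by have := (hpiv _ h).lt_pred; omega)
    (fun h => by have := hT.add_two_le_of_mem_predSet h; omega) ?_ ?_
  · rw [card_union_of_disjoint hdisj] at h
    have hD' : (#D : ℚ) ≤ 2 * #(straySucc H n) + #(strayPred H n) + 2 * #W := by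
      exact_mod_cast hcard
    have hz := hT.card_gapSet_le
    have ht4 := hT.four_le
    have hcM : (#(straySucc H n) : ℚ) ≤ #(gapSet H n) := by exact_mod_cast card_straySucc_le
    have hcF : (#(strayPred H n) : ℚ) ≤ #(gapSet H n) := by exact_mod_cast card_strayPred_le
    have hc' : (2 : ℚ) ≤ #W := by exact_mod_cast hc
    have hU' : (1 : ℚ) ≤ #U := by exact_mod_cast card_pos.2 hU
    push_cast at h
    nlinarith
  · intro p hp j hj hjD hadj
    have hpB' := hpB p hp
    by_cases hjP : j ∈ W ∪ U
    · rcases lt_trichotomy p j with hlt | rfl | hgt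
      · exact (hpiv p hp).not_adj_succ j (hpB j hjP) (Or.inl hlt) hadj
      · exact H.irrefl hadj
      · exact (hpiv j hjP).not_adj_succ p hpB' (Or.inl hgt) hadj.symm
    · rw [mem_union, not_or] at hjP
      by_cases hjA : j ∈ predSet H n
      · exact hpred j hjA hjD hjP.1 p hpB' hadj.symm
      · have hjB := (mem_union.1 hj).resolve_left hjA
        have := (hpiv p hp).lt_pred
        exact (hpiv p hp).not_adj_succ j hjB
          ((hsucc j hjB hjA hjD hjP.2).imp (by omega) id) hadj
  · intro i _ j hj hiD _ hiP _ hi hjA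
    have hjB := (mem_union.1 hj).resolve_left hjA
    exact hpred i hi hiD (fun h => hiP (mem_union_left _ h)) j hjB

/-- A tough spanning path with large degree sum always closes up to a Hamilton cycle. -/
theorem false (hT : ToughPath t n H) : False := by
  have hc : 2 ≤ #(predSet H n ∩ succSet H n) := by
    have h0 := card_pos.2 hT.inter_nonempty
    have h1 := hT.card_inter_ne_one
    omega
  have hc' : 2 ≤ #(predSet (_root_.reflect n H) n ∩ succSet (_root_.reflect n H) n) := by
    rwa [card_inter_reflect]
  have hU := hT.card_bridgedSucc_lt hc
  have hU' := hT.reflect.card_bridgedSucc_lt hc'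
  rw [← card_pos, card_bridgedSucc_reflect, card_bridgedPred_reflect] at hU'
  rw [← card_pos] at hU
  have h := hT.bridged_nonempty hc
  rw [← card_pos, ← card_pos] at h
  omega

end ToughPath

end Cases

section Bridge

variable {V : Type*} [Fintype V] [DecidableEq V] {G : SimpleGraph V} {n : ℕ} {v : ℕ → V}

theorem not_adj_of_traverses_of_not_isHamiltonian (hn : Fintype.card V = n) (hn3 : 3 ≤ n)
    (hG : ¬ G.IsHamiltonian) (hbij : Set.BijOn v (Set.Icc 1 n) Set.univ) {a b : ℕ}
    (h : Traverses (G.comap v) a b (Icc 1 n)) : ¬ G.Adj (v b) (v a) := by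
  obtain ⟨l, hne, rfl, rfl, hnd, hc, hs⟩ := h
  intro hadj
  have hmem : ∀ i ∈ l, i ∈ Set.Icc 1 n := fun i hi => by
    rw [← coe_Icc, ← hs]
    simpa using hi
  have hlen : l.length = n := by
    rw [← List.toFinset_card_of_nodup hnd, hs, Nat.card_Icc]
    omega
  have hne' : l.map v ≠ [] := by simpa using hne
  have hc' : (l.map v).IsChain G.Adj := (List.isChain_map v).2 hc
  set p := SimpleGraph.Walk.ofSupport (l.map v) hne' hc'
  have hps : p.support = l.map v := SimpleGraph.Walk.support_ofSupport hne' hc'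
  have hplen : p.length + 1 = n := by
    rw [← SimpleGraph.Walk.length_support, hps, List.length_map, hlen]
  have hp : p.IsPath := by
    rw [SimpleGraph.Walk.isPath_def, hps]
    exact hnd.map_on fun i hi j hj hij => hbij.injOn (hmem i hi) (hmem j hj) hij
  have hadj' : G.Adj ((l.map v).getLast hne') ((l.map v).head hne') := by
    rwa [List.getLast_map, List.head_map]
  refine hG fun _ => ⟨_, SimpleGraph.Walk.cons hadj' p,
    SimpleGraph.Walk.isHamiltonianCycle_iff_isCycle_and_length_eq.2 ⟨?_, ?_⟩⟩
  · rw [SimpleGraph.Walk.isCycle_iff_isPath_tail_and_le_length]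
    refine ⟨by simpa using hp, ?_⟩
    rw [SimpleGraph.Walk.length_cons]
    omega
  · rw [SimpleGraph.Walk.length_cons, hn, hplen]

theorem SimpleGraph.Tough.mul_card_image_add_card_le {t : ℚ} (htough : G.Tough t) (ht : 0 ≤ t)
    (hn : Fintype.card V = n) (hinj : Set.InjOn v (Set.Icc 1 n)) {K : Finset ℕ} {col : ℕ → ℕ}
    (hK : K ⊆ Icc 1 n) (hcol : ∀ i ∈ K, ∀ j ∈ K, G.Adj (v i) (v j) → col i = col j)
    (h2 : 2 ≤ #(K.image col)) : t * #(K.image col) + #K ≤ n := by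
  have hinjK : Set.InjOn v (K : Set ℕ) := hinj.mono (by rw [← coe_Icc]; exact_mod_cast hK)
  set S : Finset V := (K.image v)ᶜ with hS
  have hex : ∀ x : ((S : Set V)ᶜ : Set V), ∃ i ∈ K, v i = x := fun x => by
    simpa [hS] using x.2
  choose ind hindK hind using hex
  have hadj : ∀ x y, (G.induce (S : Set V)ᶜ).Adj x y → col (ind x) = col (ind y) := fun x y h =>
    hcol _ (hindK x) _ (hindK y) (by rw [hind, hind]; exact h)
  set F : (G.induce (S : Set V)ᶜ).ConnectedComponent → ℕ :=
    SimpleGraph.ConnectedComponent.lift (fun x => col (ind x)) (fun x y p _ => by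
      induction p with
      | nil => rfl
      | cons h _ ih => exact (hadj _ _ h).trans (ih (by simp_all))) with hF
  have hrange : ((K.image col : Finset ℕ) : Set ℕ) ⊆ Set.range F := by
    intro c hc
    obtain ⟨i, hi, rfl⟩ := mem_image.1 (mem_coe.1 hc)
    have hiS : v i ∈ (S : Set V)ᶜ := by
      rw [hS, coe_compl, compl_compl, mem_coe]
      exact mem_image_of_mem v hi
    refine ⟨(G.induce (S : Set V)ᶜ).connectedComponentMk ⟨v i, hiS⟩, ?_⟩
    rw [hF, SimpleGraph.ConnectedComponent.lift_mk]
    exact congrArg col (hinjK (hindK _) hi (hind ⟨v i, hiS⟩))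
  have hle : #(K.image col) ≤ Nat.card (G.induce (S : Set V)ᶜ).ConnectedComponent := by
    rw [← Set.ncard_coe_finset]
    exact (Set.ncard_le_ncard hrange (Set.finite_range F)).trans (Finite.card_range_le F)
  have h := htough S (h2.trans hle)
  have hSK : #S + #K = n := by
    rw [hS, ← card_image_of_injOn hinjK, card_compl_add_card, hn]
  have hSK' : (#S : ℚ) + #K = n := by exact_mod_cast hSK
  have hle' : (#(K.image col) : ℚ) ≤ Nat.card (G.induce (S : Set V)ᶜ).ConnectedComponent := by
    exact_mod_cast hle
  linarith [mul_le_mul_of_nonneg_left hle' ht]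

variable [DecidableRel G.Adj]

theorem degree_le_card_predSet (hbij : Set.BijOn v (Set.Icc 1 n) Set.univ) :
    G.degree (v 1) ≤ #(predSet (G.comap v) n) := by
  rw [← G.card_neighborFinset_eq_degree]
  refine (card_le_card fun x hx => ?_).trans (card_image_le (f := fun i => v (i + 1)))
  rw [G.mem_neighborFinset] at hx
  obtain ⟨i, ⟨h1, hn⟩, rfl⟩ := hbij.surjOn (Set.mem_univ x)
  have hi : i ≠ 1 := by
    rintro rfl
    exact hx.ne rfl
  refine mem_image.2 ⟨i - 1, mem_predSet.2 ⟨by omega, by omega, ?_⟩, ?_⟩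
  · rwa [SimpleGraph.comap_adj, Nat.sub_add_cancel h1]
  · rw [Nat.sub_add_cancel h1]

theorem degree_le_card_succSet (hbij : Set.BijOn v (Set.Icc 1 n) Set.univ) :
    G.degree (v n) ≤ #(succSet (G.comap v) n) := by
  rw [← G.card_neighborFinset_eq_degree]
  refine (card_le_card fun x hx => ?_).trans (card_image_le (f := fun i => v (i - 1)))
  rw [G.mem_neighborFinset] at hx
  obtain ⟨i, ⟨h1, hn⟩, rfl⟩ := hbij.surjOn (Set.mem_univ x)
  have hi : i ≠ n := by
    rintro rfl
    exact hx.ne rfl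
  exact mem_image.2 ⟨i + 1, mem_succSet.2 ⟨by omega, by omega, hx⟩, rfl⟩

/-- A Hamilton path with large degree sum in a tough graph that is not Hamiltonian. -/
theorem toughPath_comap {t : ℚ} (ht : 4 ≤ t) (hn : Fintype.card V = n) (hn3 : 3 ≤ n)
    (htough : G.Tough t) (hG : ¬ G.IsHamiltonian) (hbij : Set.BijOn v (Set.Icc 1 n) Set.univ)
    (hpath : ∀ i, 1 ≤ i → i < n → G.Adj (v i) (v (i + 1)))
    (hdeg : (n : ℚ) - t ≤ G.degree (v 1) + G.degree (v n)) : ToughPath t n (G.comap v) where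
  three_le := hn3
  adj_succ := hpath
  not_adj _ _ h := not_adj_of_traverses_of_not_isHamiltonian hn hn3 hG hbij h
  four_le := ht
  tough _ _ hK hcol h2 :=
    htough.mul_card_image_add_card_le (by linarith) hn hbij.injOn hK hcol h2
  degree_sum := by
    have h1 : (G.degree (v 1) : ℚ) ≤ #(predSet (G.comap v) n) := by
      exact_mod_cast degree_le_card_predSet hbij
    have h2 : (G.degree (v n) : ℚ) ≤ #(succSet (G.comap v) n) := by
      exact_mod_cast degree_le_card_succSet hbij
    linarith

end Bridge

end ToughClosure

/-- Let `t ≥ 4` be rational and `G` a `t`-tough non-Hamiltonian graph on `n ≥ 3`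
vertices with a Hamilton path `v 1, …, v n` from `x = v 1` to `y = v n`, where
`x ≁ y` and `deg x + deg y ≥ n − t`.  If `p` is the number of `x`-intervals and
`y`-intervals not part of a joint-interval and `q` is the number of
joint-intervals, then `p + q ≤ t − Σ_J (|J| − 1) − Σ_{J'} (|J'| − 2)`, the sums
running over all parallel-gaps `J` and all crossing-gaps `J'`. -/
theorem interval_count_bound
    {V : Type*} [Fintype V] [DecidableEq V] (G : SimpleGraph V) [DecidableRel G.Adj]
    (n : ℕ) (t : ℚ) (ht : 4 ≤ t) (hn : Fintype.card V = n) (hn3 : 3 ≤ n)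
    (htough : SimpleGraph.Tough t G) (hnotham : ¬ G.IsHamiltonian)
    (v : ℕ → V) (hbij : Set.BijOn v (Set.Icc 1 n) Set.univ)
    (hpath : ∀ i, 1 ≤ i → i < n → G.Adj (v i) (v (i + 1)))
    (hnadj : ¬ G.Adj (v 1) (v n))
    (hdeg : (n : ℚ) - t ≤ (G.degree (v 1) : ℚ) + (G.degree (v n) : ℚ))
    (p q : ℕ)
    (hp : p = Nat.card {a : ℕ × ℕ | IsInterval G v n (v 1) a.1 a.2 ∧
            ¬ ∃ b : ℕ × ℕ, IsJoint G v n a b} +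
          Nat.card {b : ℕ × ℕ | IsInterval G v n (v n) b.1 b.2 ∧
            ¬ ∃ a : ℕ × ℕ, IsJoint G v n a b})
    (hq : q = Nat.card {ab : (ℕ × ℕ) × (ℕ × ℕ) | IsJoint G v n ab.1 ab.2}) :
    (p : ℚ) + (q : ℚ) ≤ t
      - (∑ᶠ a ∈ {a : ℕ × ℕ | IsParallelGap G v n a.1 a.2},
          ((a.2 : ℚ) - (a.1 : ℚ) + 1 - 1))
      - (∑ᶠ a ∈ {a : ℕ × ℕ | IsCrossingGap G v n a.1 a.2},
          ((a.2 : ℚ) - (a.1 : ℚ) + 1 - 2)) := by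
  exact (toughPath_comap ht hn hn3 htough hnotham hbij hpath hdeg).false.elim
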